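/- For every non-negative integer ℓ and every x ∈ (0,∞)^r, one has Q_ℓ(x) = ∫_{t ∈ [0,1]^r} P_ℓ(x + t) dt. -/

import Mathlib

open MeasureTheory Complex RealInnerProductSpace
open scoped Classical

noncomputable section

/-- The data of a reduced crystallographic root system `Φ` spanning a real inner
product space `E`, together with a choice of positive system `Φ⁺`, an ordering
of the simple roots, and the corresponding fundamental dominant weights. -/
structure RootSystemData (r : ℕ) (E : Type*) [NormedAddCommGroup E] [InnerProductSpace ℝ E] where
  /-- the set of roots -/
  roots : Finset E
  /-- the set of positive roots -/
  pos : Finset E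
  /-- the (ordered) simple roots of the positive system -/
  simple : Fin r → E
  /-- the fundamental dominant weights -/
  weight : Fin r → E
  ne_zero : ∀ α ∈ roots, α ≠ (0 : E)
  span_eq : Submodule.span ℝ (roots : Set E) = ⊤
  reduced : ∀ α ∈ roots, ∀ c : ℝ, c • α ∈ roots → c = 1 ∨ c = -1
  crystallographic : ∀ α ∈ roots, ∀ β ∈ roots, ∃ z : ℤ, 2 * ⟪β, α⟫ / ⟪α, α⟫ = (z : ℝ)
  reflection_mem : ∀ α ∈ roots, ∀ β ∈ roots, β - (2 * ⟪β, α⟫ / ⟪α, α⟫) • α ∈ roots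
  pos_subset : pos ⊆ roots
  mem_pos_or : ∀ α ∈ roots, α ∈ pos ∨ -α ∈ pos
  not_both : ∀ α ∈ pos, -α ∉ pos
  simple_mem_pos : ∀ i, simple i ∈ pos
  simple_inj : Function.Injective simple
  simple_base : ∀ α ∈ pos, ∃ c : Fin r → ℕ, α = ∑ i, (c i : ℝ) • simple i
  weight_dual : ∀ i j, ⟪weight i, (2 / ⟪simple j, simple j⟫) • simple j⟫ = (if i = j then (1:ℝ) else 0)

variable {r : ℕ} {E : Type*} [NormedAddCommGroup E] [InnerProductSpace ℝ E]

/-- The pairing `(λ_i, α^∨)` of the `i`-th fundamental weight with the coroot of `α`. -/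
def RootSystemData.pairing (S : RootSystemData r E) (i : Fin r) (α : E) : ℝ :=
  ⟪S.weight i, (2 / ⟪α, α⟫) • α⟫

/-- The zeta series `ζ_Φ(s,x)` attached to the root system data. -/
def zetaRS (S : RootSystemData r E) (s : ℂ) (x : Fin r → ℝ) : ℂ :=
  ∑' m : Fin r → ℕ, ∏ α ∈ S.pos,
    (((∑ i, ((m i : ℝ) + x i) * S.pairing i α : ℝ)) : ℂ) ^ (-s)

/-- The zeta integral `𝒵_Φ(s,x)` attached to the root system data. -/
def zetaIntRS (S : RootSystemData r E) (s : ℂ) (x : Fin r → ℝ) : ℂ :=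
  ∫ t in {t : Fin r → ℝ | ∀ i, 0 < t i}, ∏ α ∈ S.pos,
    (((∑ i, (t i + x i) * S.pairing i α : ℝ)) : ℂ) ^ (-s)

/-- `v` is the value `P_ℓ(x) = ζ_Φ(-ℓ,x)` of the meromorphic continuation of the
zeta series at `s = -ℓ`. -/
def IsPValue (S : RootSystemData r E) (l : ℕ) (x : Fin r → ℝ) (v : ℂ) : Prop :=
  ∃ F : ℂ → ℂ, (∀ s : ℂ, (r : ℝ) < s.re → F s = zetaRS S s x) ∧
    MeromorphicOn F Set.univ ∧ AnalyticAt ℂ F (-(l : ℂ)) ∧ F (-(l : ℂ)) = v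

/-- `v` is the value `Q_ℓ(x) = 𝒵_Φ(-ℓ,x)` of the meromorphic continuation of the
zeta integral at `s = -ℓ`. -/
def IsQValue (S : RootSystemData r E) (l : ℕ) (x : Fin r → ℝ) (v : ℂ) : Prop :=
  ∃ F : ℂ → ℂ, (∀ s : ℂ, (r : ℝ) < s.re → F s = zetaIntRS S s x) ∧
    MeromorphicOn F Set.univ ∧ AnalyticAt ℂ F (-(l : ℂ)) ∧ F (-(l : ℂ)) = v

theorem intervalIntegral_indicator_Iio {z T : ℝ} (hz : 0 ≤ z) (hT : z ≤ T) :
    ∫ τ in (0 : ℝ)..T, (Set.Iio z).indicator (fun _ => (1 : ℝ)) τ = z := by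
  rw [intervalIntegral.integral_of_le (hz.trans hT), ← integral_Icc_eq_integral_Ioc,
    setIntegral_indicator measurableSet_Iio]
  have : Set.Icc 0 T ∩ Set.Iio z = Set.Ico 0 z := by
    ext τ; simp only [Set.mem_inter_iff, Set.mem_Icc, Set.mem_Iio, Set.mem_Ico]
    constructor
    · rintro ⟨⟨h1, _⟩, h2⟩; exact ⟨h1, h2⟩
    · rintro ⟨h1, h2⟩; exact ⟨⟨h1, by linarith⟩, h2⟩
  rw [this]
  simp [hz]

theorem intervalIntegrable_indicator_Iio (z T : ℝ) :
    IntervalIntegrable ((Set.Iio z).indicator fun _ => (1 : ℝ)) volume 0 T := by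
  have h : IntervalIntegrable (fun _ : ℝ => (1 : ℝ)) volume 0 T := intervalIntegrable_const
  exact ⟨h.1.indicator measurableSet_Iio, h.2.indicator measurableSet_Iio⟩

/-- If `∑_{S i ⊆ A} k i ≤ ∑_{α ∈ A} e α` for every `A`, then `∑ k i * min_{S i} x ≤ ∑ e α * x α`
for all non-negative `x`. -/
theorem sum_mul_le_sum_mul_of_forall_subset {ι κ : Type*} [Fintype ι] [Fintype κ]
    (S : κ → Finset ι) (hS : ∀ i, (S i).Nonempty) (k : κ → ℝ) (hk : ∀ i, 0 ≤ k i) (e : ι → ℝ)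
    (h : ∀ A : Finset ι, ∑ i with S i ⊆ A, k i ≤ ∑ α ∈ A, e α)
    (x : ι → ℝ) (hx : ∀ α, 0 ≤ x α) (μ : κ → ℝ) (hμ : ∀ i, ∀ α ∈ S i, μ i ≤ x α) :
    ∑ i, k i * μ i ≤ ∑ α, e α * x α := by
  set T := ∑ α, x α
  have hxT : ∀ α, x α ≤ T := fun α =>
    Finset.single_le_sum (f := x) (fun β _ => hx β) (Finset.mem_univ α)
  have hT : 0 ≤ T := Finset.sum_nonneg fun α _ => hx α
  have hμT : ∀ i, max (μ i) 0 ≤ T := fun i => by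
    obtain ⟨α, hα⟩ := hS i
    exact max_le ((hμ i α hα).trans (hxT α)) hT
  have hint : ∀ a z : ℝ, IntervalIntegrable
      (fun τ => a * (Set.Iio z).indicator (fun _ => (1 : ℝ)) τ) volume 0 T :=
    fun a z => (intervalIntegrable_indicator_Iio z T).const_mul a
  calc ∑ i, k i * μ i ≤ ∑ i, k i * max (μ i) 0 :=
        Finset.sum_le_sum fun i _ => mul_le_mul_of_nonneg_left (le_max_left _ _) (hk i)
    _ = ∫ τ in (0 : ℝ)..T, ∑ i, k i * (Set.Iio (max (μ i) 0)).indicator (fun _ => (1 : ℝ)) τ := by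
        rw [intervalIntegral.integral_finsetSum fun i _ => hint _ _]
        refine Finset.sum_congr rfl fun i _ => ?_
        rw [intervalIntegral.integral_const_mul,
          intervalIntegral_indicator_Iio (le_max_right _ _) (hμT i)]
    _ ≤ ∫ τ in (0 : ℝ)..T, ∑ α, e α * (Set.Iio (x α)).indicator (fun _ => (1 : ℝ)) τ := by
        refine intervalIntegral.integral_mono_on hT ?_ ?_ fun τ hτ => ?_
        · simpa only [Finset.sum_fn] using IntervalIntegrable.sum Finset.univ fun i _ => hint (k i) (max (μ i) 0)
        · simpa only [Finset.sum_fn] using IntervalIntegrable.sum Finset.univ fun α _ => hint (e α) (x α)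
        · have h1 := h (Finset.univ.filter fun α => τ < x α)
          simp only [Set.indicator_apply, Set.mem_Iio, mul_ite, mul_one, mul_zero]
          rw [← Finset.sum_filter, ← Finset.sum_filter]
          refine le_trans ?_ h1
          refine Finset.sum_le_sum_of_subset_of_nonneg ?_ fun i _ _ => hk i
          intro i hi
          simp only [Finset.mem_filter, Finset.mem_univ, true_and] at hi ⊢
          intro α hα
          simp only [Finset.mem_filter, Finset.mem_univ, true_and]
          rcases lt_max_iff.1 hi with hi | hi
          · exact hi.trans_le (hμ i α hα)
          · exact absurd hi (not_lt.2 hτ.1)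
    _ = ∑ α, e α * x α := by
        rw [intervalIntegral.integral_finsetSum fun i _ => hint _ _]
        refine Finset.sum_congr rfl fun α _ => ?_
        rw [intervalIntegral.integral_const_mul, intervalIntegral_indicator_Iio (hx α) (hxT α)]

section Gamma

/-- The Mellin integral `∫ u^(s-1) exp(-L u) du` in the logarithmic coordinate `u = exp t`. -/
theorem integral_cexp_mul_exp_neg_mul_exp {s : ℂ} (hs : 0 < s.re) {L : ℝ} (hL : 0 < L) :
    ∫ t : ℝ, cexp (s * t) * (Real.exp (-(L * Real.exp t)) : ℂ) = (L : ℂ) ^ (-s) * Gamma s := by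
  have h1 := Complex.integral_cpow_mul_exp_neg_mul_Ioi (a := s) (r := L) hs (by simpa using hL)
  have h2 := integral_image_eq_integral_abs_deriv_smul (s := Set.univ) (f := Real.exp)
    (f' := Real.exp) MeasurableSet.univ (fun x _ => (Real.hasDerivAt_exp x).hasDerivWithinAt)
    (Real.exp_injective.injOn) (fun t : ℝ => (t : ℂ) ^ (s - 1) * cexp (-(L * t)))
  rw [Set.image_univ, Real.range_exp, h1] at h2
  have hL' : (L : ℂ) ≠ 0 := by exact_mod_cast hL.ne'
  have : (L : ℂ) ^ (-s) = (1 / (L : ℂ)) ^ s := by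
    rw [one_div, Complex.inv_cpow _ _ (by rw [Complex.arg_ofReal_of_nonneg hL.le]; exact Real.pi_pos.ne),
      Complex.cpow_neg]
  rw [this, h2, setIntegral_univ]
  refine integral_congr_ae (Filter.Eventually.of_forall fun t => ?_)
  have he : (Real.exp t : ℂ) ≠ 0 := by exact_mod_cast (Real.exp_pos t).ne'
  simp only [abs_of_pos (Real.exp_pos t), Complex.real_smul]
  rw [Complex.cpow_def_of_ne_zero he, ← Complex.ofReal_log (Real.exp_pos t).le, Real.log_exp]
  push_cast
  rw [← Complex.exp_add, ← mul_assoc, ← Complex.exp_add, ← Complex.exp_add]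
  congr 1; ring

theorem integrable_exp_mul_exp_neg_mul_exp {p L : ℝ} (hp : 0 < p) (hL : 0 < L) :
    Integrable fun t : ℝ => Real.exp (p * t) * Real.exp (-(L * Real.exp t)) := by
  by_contra h
  have h1 := integral_cexp_mul_exp_neg_mul_exp (s := p) (by simpa using hp) hL
  have h2 : (fun t : ℝ => cexp (p * t) * (Real.exp (-(L * Real.exp t)) : ℂ)) =
      fun t : ℝ => ((Real.exp (p * t) * Real.exp (-(L * Real.exp t)) : ℝ) : ℂ) := by
    ext t; push_cast; rfl
  rw [h2, integral_complex_ofReal, integral_undef h] at h1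
  have h3 : (L : ℂ) ^ (-(p : ℂ)) * Gamma p ≠ 0 := by
    refine mul_ne_zero ?_ (Complex.Gamma_ne_zero_of_re_pos (by simpa using hp))
    simp [Complex.cpow_eq_zero_iff, hL.ne']
  exact h3 (by simpa using h1.symm)

end Gamma

/-- `D * max t 0` is dominated by any positive multiple of `exp t`, up to a constant. -/
theorem exists_mul_max_le_add_mul_exp (D : ℝ) (hD : 0 ≤ D) {η : ℝ} (hη : 0 < η) :
    ∃ K : ℝ, ∀ t : ℝ, D * max t 0 ≤ K + η * Real.exp t := by
  rcases hD.eq_or_lt with rfl | hD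
  · exact ⟨0, fun t => by simpa using (by positivity : 0 ≤ η * Real.exp t)⟩
  · refine ⟨D * |Real.log (η / D)|, fun t => ?_⟩
    have h1 := Real.add_one_le_exp (t + Real.log (η / D))
    rw [Real.exp_add, Real.exp_log (by positivity)] at h1
    have h2 := neg_abs_le (Real.log (η / D))
    have h3 : max t 0 ≤ |Real.log (η / D)| + Real.exp t * (η / D) :=
      max_le (by linarith) (by positivity)
    calc D * max t 0 ≤ D * (|Real.log (η / D)| + Real.exp t * (η / D)) :=
          mul_le_mul_of_nonneg_left h3 hD.le
      _ = _ := by field_simp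

/-- Holomorphy of a parametric integral whose integrand is holomorphic and locally dominated. -/
theorem differentiableOn_integral_of_locally_dominated {X : Type*} [MeasurableSpace X]
    {μ : Measure X} {U : Set ℂ} (hU : IsOpen U) {f : ℂ → X → ℂ}
    (hmeas : ∀ s ∈ U, AEStronglyMeasurable (f s) μ)
    (hd : ∀ᵐ a ∂μ, DifferentiableOn ℂ (fun s => f s a) U)
    (hb : ∀ s₀ ∈ U, ∃ V ∈ nhds s₀, ∃ B : X → ℝ, Integrable B μ ∧
      ∀ᵐ a ∂μ, ∀ s ∈ V, ‖f s a‖ ≤ B a) :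
    DifferentiableOn ℂ (fun s => ∫ a, f s a ∂μ) U := by
  intro s₀ hs₀
  obtain ⟨V, hV, B, hB, hfB⟩ := hb s₀ hs₀
  obtain ⟨ε, hε, hball⟩ := Metric.mem_nhds_iff.1 (Filter.inter_mem hV (hU.mem_nhds hs₀))
  have hsub : ∀ s ∈ Metric.ball s₀ (ε / 2), Metric.closedBall s (ε / 4) ⊆ V ∩ U := by
    intro s hs z hz
    refine hball ?_
    rw [Metric.mem_ball] at hs ⊢
    rw [Metric.mem_closedBall] at hz
    linarith [dist_triangle z s s₀]
  have hs₀' : s₀ ∈ Metric.ball s₀ (ε / 2) := Metric.mem_ball_self (by positivity)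
  have hdiff : ∀ᵐ a ∂μ, ∀ s ∈ Metric.ball s₀ (ε / 2),
      HasDerivAt (fun s => f s a) (deriv (fun s => f s a) s) s := by
    filter_upwards [hd] with a ha s hs
    exact (ha.differentiableAt (hU.mem_nhds
      (hsub s hs (Metric.mem_closedBall_self (by positivity))).2)).hasDerivAt
  have hderivmeas : AEStronglyMeasurable (fun a => deriv (fun s => f s a) s₀) μ := by
    let u : ℕ → ℂ := fun n => ((ε / 4 / (n + 1) : ℝ) : ℂ)
    have hu0 : ∀ n, u n ≠ 0 := fun n => by
      simp only [u]; exact_mod_cast (by positivity : (ε / 4 / ((n : ℝ) + 1)) ≠ 0)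
    have hu : Filter.Tendsto u Filter.atTop (nhdsWithin 0 {0}ᶜ) := by
      refine tendsto_nhdsWithin_iff.2 ⟨?_, Filter.Eventually.of_forall fun n => hu0 n⟩
      rw [← Complex.ofReal_zero]
      refine (Complex.continuous_ofReal.tendsto 0).comp ?_
      have := (tendsto_one_div_add_atTop_nhds_zero_nat (𝕜 := ℝ)).const_mul (ε / 4)
      simpa [div_eq_mul_inv] using this
    refine aestronglyMeasurable_of_tendsto_ae Filter.atTop
      (f := fun n a => (u n)⁻¹ • (f (s₀ + u n) a - f s₀ a)) (fun n => ?_) ?_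
    · refine (AEStronglyMeasurable.sub (hmeas _ ?_) (hmeas _ hs₀)).const_smul (u n)⁻¹
      refine (hsub s₀ hs₀' ?_).2
      rw [Metric.mem_closedBall, dist_eq_norm, add_sub_cancel_left, Complex.norm_real,
        Real.norm_of_nonneg (by positivity)]
      exact div_le_self (by positivity) (by linarith [Nat.cast_nonneg (α := ℝ) n])
    · filter_upwards [hdiff] with a ha
      exact (hasDerivAt_iff_tendsto_slope_zero.1 (ha s₀ hs₀')).comp hu
  have hbound : ∀ᵐ a ∂μ, ∀ s ∈ Metric.ball s₀ (ε / 2),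
      ‖deriv (fun s => f s a) s‖ ≤ B a / (ε / 4) := by
    filter_upwards [hd, hfB] with a ha hBa s hs
    refine Complex.norm_deriv_le_of_forall_mem_sphere_norm_le (by positivity)
      (DifferentiableOn.diffContOnCl_ball (U := U) ha fun z hz => (hsub s hs hz).2) fun z hz =>
      hBa z (hsub s hs (Metric.sphere_subset_closedBall hz)).1
  refine (hasDerivAt_integral_of_dominated_loc_of_deriv_le
    (F' := fun s a => deriv (fun s => f s a) s) (Metric.ball_mem_nhds s₀ (half_pos hε)) ?_ ?_
    hderivmeas hbound (hB.div_const _) hdiff).2.differentiableAt.differentiableWithinAt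
  · exact Filter.eventually_of_mem (hU.mem_nhds hs₀) hmeas
  · exact hB.mono' (hmeas _ hs₀) (hfB.mono fun a ha => ha s₀ (mem_of_mem_nhds hV))

/-- A sequence of functions on `(0, ∞)`, each the derivative of the previous one, all of
subexponential growth and bounded near `0`. -/
structure IsDerivTower (b : ℕ → ℝ → ℝ) : Prop where
  hasDerivAt : ∀ j w, 0 < w → HasDerivAt (b j) (b (j + 1) w) w
  bound : ∀ j, ∀ δ : ℝ, 0 < δ → ∃ C : ℝ, 0 ≤ C ∧ ∀ w, 0 < w → |b j w| ≤ C * Real.exp (δ * w)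

/-- A non-negative matrix without zero rows and columns. -/
structure IsPairing {ι κ : Type*} (c : κ → ι → ℝ) : Prop where
  nonneg : ∀ i α, 0 ≤ c i α
  row : ∀ i, ∃ α, 0 < c i α
  col : ∀ α, ∃ i, 0 < c i α

namespace ConeZeta

variable {ι κ : Type*}

/-- The linear form `∑ α, c i α * u α` at `u = exp a`. -/
def rowForm [Fintype ι] (c : κ → ι → ℝ) (i : κ) (a : ι → ℝ) : ℝ := ∑ α, c i α * Real.exp (a α)

/-- The linear form `∑ i, y i * c i α`. -/
def colForm [Fintype κ] (c : κ → ι → ℝ) (y : κ → ℝ) (α : ι) : ℝ := ∑ i, y i * c i α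

/-- The set of columns in which the `i`-th row is non-zero. -/
def rowSupp [Fintype ι] (c : κ → ι → ℝ) (i : κ) : Finset ι := Finset.univ.filter fun α => c i α ≠ 0

theorem rowForm_pos [Fintype ι] {c : κ → ι → ℝ} (hc : IsPairing c) (i : κ) (a : ι → ℝ) : 0 < rowForm c i a := by
  obtain ⟨α, hα⟩ := hc.row i
  exact Finset.sum_pos' (fun β _ => mul_nonneg (hc.nonneg i β) (Real.exp_pos _).le)
    ⟨α, Finset.mem_univ α, mul_pos hα (Real.exp_pos _)⟩

theorem colForm_pos [Fintype κ] {c : κ → ι → ℝ} (hc : IsPairing c) {y : κ → ℝ} (hy : ∀ i, 0 < y i) (α : ι) :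
    0 < colForm c y α := by
  obtain ⟨i, hi⟩ := hc.col α
  exact Finset.sum_pos' (fun l _ => mul_nonneg (hy l).le (hc.nonneg l α))
    ⟨i, Finset.mem_univ i, mul_pos (hy i) hi⟩

theorem continuous_rowForm [Fintype ι] {c : κ → ι → ℝ} (i : κ) : Continuous (rowForm c i) := by
  unfold rowForm; fun_prop

theorem continuous_colForm [Fintype κ] {c : κ → ι → ℝ} (α : ι) : Continuous fun y => colForm c y α := by
  unfold colForm; fun_prop

variable [Fintype ι] [Fintype κ]

/-- The part of the Mellin integrand that does not involve `s`. -/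
def amplitude (c : κ → ι → ℝ) (b : ℕ → ℝ → ℝ) (k j : κ → ℕ) (y : κ → ℝ) (a : ι → ℝ) : ℝ :=
  (∏ i, (rowForm c i a ^ k i)⁻¹ * b (j i) (rowForm c i a)) *
    Real.exp (-∑ α, colForm c y α * Real.exp (a α))

/-- The Mellin integrand, in logarithmic coordinates. -/
def integrand (c : κ → ι → ℝ) (b : ℕ → ℝ → ℝ) (e : ι → ℕ) (k j : κ → ℕ) (s : ℂ) (y : κ → ℝ)
    (a : ι → ℝ) : ℂ :=
  cexp (∑ α, (s + e α) * a α) * amplitude c b k j y a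

/-- The Mellin integral. -/
def mellinInt (c : κ → ι → ℝ) (b : ℕ → ℝ → ℝ) (e : ι → ℕ) (k j : κ → ℕ) (s : ℂ) (y : κ → ℝ) : ℂ :=
  ∫ a, integrand c b e k j s y a

/-- The scaling degree, in the variables indexed by `A`, of `∏ u α ^ e α * ∏ w i ^ (-k i)`. -/
def degree (c : κ → ι → ℝ) (e : ι → ℕ) (k : κ → ℕ) (A : Finset ι) : ℤ :=
  ∑ α ∈ A, (e α : ℤ) - ∑ i with rowSupp c i ⊆ A, (k i : ℤ)

/-- All scaling degrees are at least `N` per variable. -/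
def DegreeGE (c : κ → ι → ℝ) (N : ℤ) (e : ι → ℕ) (k : κ → ℕ) : Prop :=
  ∀ A : Finset ι, N * A.card ≤ degree c e k A

/-- The integrable majorant of the Mellin integrand. -/
def majorant (p q η : ℝ) (a : ι → ℝ) : ℝ :=
  ∏ α, (Real.exp (p * a α) + Real.exp (q * a α)) * Real.exp (-(η * Real.exp (a α)))

theorem integrable_majorant {p q η : ℝ} (hp : 0 < p) (hq : 0 < q) (hη : 0 < η) :
    Integrable (majorant p q η : (ι → ℝ) → ℝ) := by
  refine Integrable.fintype_prod (f := fun _ t =>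
    (Real.exp (p * t) + Real.exp (q * t)) * Real.exp (-(η * Real.exp t))) fun α => ?_
  simp only [add_mul]
  exact (integrable_exp_mul_exp_neg_mul_exp hp hη).add (integrable_exp_mul_exp_neg_mul_exp hq hη)

variable {c : κ → ι → ℝ} {b : ℕ → ℝ → ℝ}

theorem continuous_amplitude (hc : IsPairing c) (hb : IsDerivTower b) (k j : κ → ℕ) :
    Continuous fun q : (κ → ℝ) × (ι → ℝ) => amplitude c b k j q.1 q.2 := by
  unfold amplitude
  refine Continuous.mul (continuous_finsetProd _ fun i _ => ?_) ?_
  · have h1 : Continuous fun q : (κ → ℝ) × (ι → ℝ) => rowForm c i q.2 :=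
      (continuous_rowForm i).comp continuous_snd
    refine ((h1.pow _).inv₀ fun q => pow_ne_zero _ (rowForm_pos hc i _).ne').mul ?_
    refine continuous_iff_continuousAt.2 fun q => ?_
    exact ContinuousAt.comp (f := fun q : (κ → ℝ) × (ι → ℝ) => rowForm c i q.2)
      (hb.hasDerivAt (j i) _ (rowForm_pos hc i q.2)).continuousAt h1.continuousAt
  · refine Real.continuous_exp.comp (continuous_finsetSum _ fun α _ => ?_).neg
    have := (continuous_colForm (c := c) α).comp (continuous_fst (X := κ → ℝ) (Y := ι → ℝ))
    exact this.mul (by fun_prop)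

theorem continuous_integrand (hc : IsPairing c) (hb : IsDerivTower b) (e : ι → ℕ) (k j : κ → ℕ) :
    Continuous fun q : (ℂ × (κ → ℝ)) × (ι → ℝ) => integrand c b e k j q.1.1 q.1.2 q.2 := by
  unfold integrand
  have h := (continuous_amplitude hc hb k j).comp
    (f := fun q : (ℂ × (κ → ℝ)) × (ι → ℝ) => (q.1.2, q.2)) (by fun_prop)
  exact Continuous.mul (by fun_prop) (Complex.continuous_ofReal.comp h)

/-- The scaling bound: the singular factors are controlled by the degrees. -/
theorem exists_degree_bound (hc : IsPairing c) {N : ℤ} {e : ι → ℕ} {k : κ → ℕ}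
    (hd : DegreeGE c N e k) {η : ℝ} (hη : 0 < η) :
    ∃ K : ℝ, ∀ a : ι → ℝ, ∑ α, (e α - N : ℝ) * a α - ∑ i, k i * Real.log (rowForm c i a) ≤
      K + η * ∑ α, Real.exp (a α) := by
  have hK := fun α => exists_mul_max_le_add_mul_exp |(e α - N : ℝ)| (abs_nonneg _) hη
  choose K hK using hK
  let m : κ → ℝ := fun i => ∑ α, |Real.log (c i α)|
  refine ⟨∑ α, K α + ∑ i, k i * m i, fun a => ?_⟩
  have h1 : ∑ i, (k i : ℝ) * (-Real.log (rowForm c i a) - m i) ≤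
      ∑ α, (e α - N : ℝ) * max (-a α) 0 := by
    refine sum_mul_le_sum_mul_of_forall_subset (rowSupp c) (fun i => ?_) _
      (fun i => Nat.cast_nonneg _) _ (fun A => ?_) _ (fun α => le_max_right _ _) _
      fun i α hα => ?_
    · obtain ⟨α, hα⟩ := hc.row i
      exact ⟨α, by simp [rowSupp, hα.ne']⟩
    · have := hd A
      rw [degree, le_sub_iff_add_le] at this
      rw [Finset.sum_sub_distrib, Finset.sum_const, nsmul_eq_mul, le_sub_iff_add_le, mul_comm,
        add_comm]
      exact_mod_cast this
    · have hcα : 0 < c i α := lt_of_le_of_ne (hc.nonneg i α)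
        (Ne.symm (by simpa [rowSupp] using hα))
      have h2 : c i α * Real.exp (a α) ≤ rowForm c i a :=
        Finset.single_le_sum (f := fun α => c i α * Real.exp (a α))
          (fun β _ => mul_nonneg (hc.nonneg i β) (Real.exp_pos _).le) (Finset.mem_univ α)
      have h3 := Real.log_le_log (mul_pos hcα (Real.exp_pos _)) h2
      rw [Real.log_mul hcα.ne' (Real.exp_pos _).ne', Real.log_exp] at h3
      have h4 : |Real.log (c i α)| ≤ m i :=
        Finset.single_le_sum (f := fun α => |Real.log (c i α)|) (fun β _ => abs_nonneg _)
          (Finset.mem_univ α)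
      have h5 := neg_abs_le (Real.log (c i α))
      exact le_max_of_le_left (by linarith)
  have h2 : ∑ α, ((e α - N : ℝ) * a α + (e α - N : ℝ) * max (-a α) 0) ≤
      ∑ α, (K α + η * Real.exp (a α)) := by
    refine Finset.sum_le_sum fun α _ => le_trans ?_ (hK α (a α))
    have h3 : max (a α) 0 = a α + max (-a α) 0 := by
      rcases le_total (a α) 0 with h | h
      · rw [max_eq_right h, max_eq_left (by linarith)]; ring
      · rw [max_eq_left h, max_eq_right (by linarith)]; ring
    rw [← mul_add, ← h3]
    exact mul_le_mul_of_nonneg_right (le_abs_self _) (le_max_right _ _)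
  simp only [mul_sub, Finset.sum_sub_distrib, mul_neg, Finset.sum_neg_distrib] at h1
  simp only [Finset.sum_add_distrib, ← Finset.mul_sum] at h2
  linarith

theorem exists_norm_integrand_le (hc : IsPairing c) (hb : IsDerivTower b) {N : ℤ} {e : ι → ℕ}
    {k : κ → ℕ} (hd : DegreeGE c N e k) (j : κ → ℕ) {η : ℝ} (hη : 0 < η) :
    ∃ C : ℝ, 0 ≤ C ∧ ∀ (y : κ → ℝ) (s : ℂ) (a : ι → ℝ), (∀ α, η ≤ colForm c y α) →
      ‖integrand c b e k j s y a‖ ≤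
        C * ∏ α, Real.exp ((s.re + N) * a α) * Real.exp (-(η / 2 * Real.exp (a α))) := by
  obtain ⟨K, hK⟩ := exists_degree_bound hc hd (η := η / 4) (by positivity)
  let δ : ℝ := η / 4 / (1 + ∑ α, ∑ i, c i α)
  have hsum : ∀ α, 0 ≤ ∑ i, c i α := fun α => Finset.sum_nonneg fun i _ => hc.nonneg i α
  have hpos : 0 < 1 + ∑ α, ∑ i, c i α := by
    have := Finset.sum_nonneg fun α (_ : α ∈ Finset.univ) => hsum α
    linarith
  have hδ : 0 < δ := by positivity
  choose C hC0 hC using fun i => hb.bound (j i) δ hδ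
  refine ⟨(∏ i, C i) * Real.exp K, mul_nonneg (Finset.prod_nonneg fun i _ => hC0 i)
    (Real.exp_pos _).le, fun y s a hy => ?_⟩
  have hW := fun i => rowForm_pos hc i a
  have hδW : ∑ i, δ * rowForm c i a ≤ η / 4 * ∑ α, Real.exp (a α) := by
    simp only [rowForm, ← Finset.mul_sum]
    rw [Finset.sum_comm]
    simp only [← Finset.sum_mul]
    rw [Finset.mul_sum, Finset.mul_sum]
    refine Finset.sum_le_sum fun α _ => ?_
    rw [← mul_assoc]
    refine mul_le_mul_of_nonneg_right ?_ (Real.exp_pos _).le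
    have h1 : ∑ i, c i α ≤ ∑ α, ∑ i, c i α :=
      Finset.single_le_sum (f := fun α => ∑ i, c i α) (fun β _ => hsum β) (Finset.mem_univ α)
    calc δ * ∑ i, c i α ≤ δ * (1 + ∑ α, ∑ i, c i α) :=
          mul_le_mul_of_nonneg_left (by linarith) hδ.le
      _ = η / 4 := by simp only [δ]; field_simp
  have hcol : η * ∑ α, Real.exp (a α) ≤ ∑ α, colForm c y α * Real.exp (a α) := by
    rw [Finset.mul_sum]
    exact Finset.sum_le_sum fun α _ => mul_le_mul_of_nonneg_right (hy α) (Real.exp_pos _).le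
  have hre : (∑ α, (s + e α) * a α).re = ∑ α, (s.re + e α) * a α := by
    simp [Complex.re_sum, Complex.mul_re]
  have hprod : |∏ i, (rowForm c i a ^ k i)⁻¹ * b (j i) (rowForm c i a)| ≤
      (∏ i, C i) * Real.exp (∑ i, (-(k i * Real.log (rowForm c i a)) + δ * rowForm c i a)) := by
    rw [Finset.abs_prod, Real.exp_sum, ← Finset.prod_mul_distrib]
    refine Finset.prod_le_prod (fun i _ => abs_nonneg _) fun i _ => ?_
    rw [abs_mul, abs_of_pos (by have := hW i; positivity), Real.exp_add, Real.exp_neg,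
      mul_comm (k i : ℝ), Real.exp_mul, Real.exp_log (hW i), Real.rpow_natCast, mul_left_comm]
    exact mul_le_mul_of_nonneg_left (hC i _ (hW i)) (by have := hW i; positivity)
  rw [integrand, norm_mul, Complex.norm_exp, hre, Complex.norm_real, Real.norm_eq_abs, amplitude,
    abs_mul, abs_of_pos (Real.exp_pos _)]
  calc _ ≤ Real.exp (∑ α, (s.re + e α) * a α) * (((∏ i, C i) *
        Real.exp (∑ i, (-(k i * Real.log (rowForm c i a)) + δ * rowForm c i a))) *
        Real.exp (-∑ α, colForm c y α * Real.exp (a α))) := by gcongr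
    _ = (∏ i, C i) * Real.exp (∑ α, (s.re + e α) * a α +
        ∑ i, (-(k i * Real.log (rowForm c i a)) + δ * rowForm c i a) +
        -∑ α, colForm c y α * Real.exp (a α)) := by
        rw [Real.exp_add, Real.exp_add]; ring
    _ ≤ (∏ i, C i) * Real.exp (K + ∑ α, ((s.re + N) * a α + -(η / 2 * Real.exp (a α)))) := by
        refine mul_le_mul_of_nonneg_left (Real.exp_le_exp.2 ?_)
          (Finset.prod_nonneg fun i _ => hC0 i)
        have h1 := hK a
        have h2 : ∑ α, (s.re + e α) * a α = ∑ α, (s.re + N) * a α + ∑ α, (e α - N : ℝ) * a α := by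
          rw [← Finset.sum_add_distrib]
          exact Finset.sum_congr rfl fun α _ => by ring
        simp only [Finset.sum_add_distrib, Finset.sum_neg_distrib, ← Finset.mul_sum] at h1 h2 hδW ⊢
        linarith
    _ = _ := by
        rw [Real.exp_add, Real.exp_sum, mul_assoc]
        simp only [Real.exp_add]

theorem prod_exp_le_majorant {p q σ η : ℝ} (hp : p ≤ σ) (hq : σ ≤ q) (a : ι → ℝ) :
    ∏ α, Real.exp (σ * a α) * Real.exp (-(η * Real.exp (a α))) ≤ majorant p q η a := by
  refine Finset.prod_le_prod (fun α _ => by positivity) fun α _ => ?_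
  refine mul_le_mul_of_nonneg_right ?_ (Real.exp_pos _).le
  rcases le_total 0 (a α) with h | h
  · exact (Real.exp_le_exp.2 (mul_le_mul_of_nonneg_right hq h)).trans
      (le_add_of_nonneg_left (Real.exp_pos _).le)
  · exact (Real.exp_le_exp.2 (mul_le_mul_of_nonpos_right hp h)).trans
      (le_add_of_nonneg_right (Real.exp_pos _).le)

/-- Local domination of the Mellin integrand. -/
theorem exists_local_bound (hc : IsPairing c) (hb : IsDerivTower b) {N : ℤ} {e : ι → ℕ}
    {k : κ → ℕ} (hd : DegreeGE c N e k) (j : κ → ℕ) {s₀ : ℂ} (hs₀ : -(N : ℝ) < s₀.re)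
    {y₀ : κ → ℝ} (hy₀ : ∀ i, 0 < y₀ i) :
    ∃ V ∈ nhds s₀, ∃ W ∈ nhds y₀, ∃ B : (ι → ℝ) → ℝ, Integrable B ∧
      ∀ s ∈ V, ∀ y ∈ W, ∀ a, ‖integrand c b e k j s y a‖ ≤ B a := by
  obtain ⟨η, hη, hηy⟩ : ∃ η : ℝ, 0 < η ∧ ∀ α, η < colForm c y₀ α := by
    rcases isEmpty_or_nonempty ι with h | h
    · exact ⟨1, one_pos, fun α => (IsEmpty.false α).elim⟩
    · obtain ⟨α₀, hα₀⟩ := Finite.exists_min (colForm c y₀)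
      have := colForm_pos hc hy₀ α₀
      exact ⟨colForm c y₀ α₀ / 2, by positivity, fun α => by linarith [hα₀ α]⟩
  obtain ⟨C, hC0, hC⟩ := exists_norm_integrand_le hc hb hd j hη
  obtain ⟨p, hp1, hp2⟩ := exists_between (show 0 < s₀.re + N by linarith)
  refine ⟨{s | p < s.re + N ∧ s.re + N < s₀.re + N + 1}, ?_, {y | ∀ α, η < colForm c y α}, ?_,
    fun a => C * majorant p (s₀.re + N + 1) (η / 2) a,
    (integrable_majorant hp1 (by linarith) (by positivity)).const_mul C, ?_⟩
  · refine IsOpen.mem_nhds ?_ ⟨hp2, by linarith⟩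
    have h : Continuous fun s : ℂ => s.re + N := by fun_prop
    exact (isOpen_lt continuous_const h).inter (isOpen_lt h continuous_const)
  · refine IsOpen.mem_nhds ?_ hηy
    simp only [Set.ofPred_forall]
    exact isOpen_iInter_of_finite fun α => isOpen_lt continuous_const (continuous_colForm α)
  · intro s hs y hy a
    exact (hC y s a fun α => (hy α).le).trans
      (mul_le_mul_of_nonneg_left (prod_exp_le_majorant hs.1.le hs.2.le a) hC0)

theorem integrable_integrand (hc : IsPairing c) (hb : IsDerivTower b) {N : ℤ} {e : ι → ℕ}
    {k : κ → ℕ} (hd : DegreeGE c N e k) (j : κ → ℕ) {s : ℂ} (hs : -(N : ℝ) < s.re)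
    {y : κ → ℝ} (hy : ∀ i, 0 < y i) : Integrable (integrand c b e k j s y) := by
  obtain ⟨V, hV, W, hW, B, hB, h⟩ := exists_local_bound hc hb hd j hs hy
  refine hB.mono' ?_ (Filter.Eventually.of_forall fun a =>
    h s (mem_of_mem_nhds hV) y (mem_of_mem_nhds hW) a)
  exact ((continuous_integrand hc hb e k j).comp
    (f := fun a => ((s, y), a)) (by fun_prop)).aestronglyMeasurable

/-- Joint continuity on `{-M < re s} × (0, ∞)^κ`, and holomorphy in `s`. -/
structure IsHolomorphicFamily (M : ℝ) (f : ℂ → (κ → ℝ) → ℂ) : Prop where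
  continuousOn : ContinuousOn (fun q : ℂ × (κ → ℝ) => f q.1 q.2)
    ({s | -M < s.re} ×ˢ {y | ∀ i, 0 < y i})
  differentiableOn : ∀ y : κ → ℝ, (∀ i, 0 < y i) →
    DifferentiableOn ℂ (fun s => f s y) {s | -M < s.re}

theorem isHolomorphicFamily_mellinInt (hc : IsPairing c) (hb : IsDerivTower b) {N : ℤ} {e : ι → ℕ}
    {k : κ → ℕ} (hd : DegreeGE c N e k) (j : κ → ℕ) :
    IsHolomorphicFamily N (mellinInt c b e k j) where
  continuousOn := by
    rintro ⟨s₀, y₀⟩ ⟨hs₀, hy₀⟩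
    obtain ⟨V, hV, W, hW, B, hB, h⟩ := exists_local_bound hc hb hd j hs₀ hy₀
    refine ContinuousAt.continuousWithinAt ?_
    refine continuousAt_of_dominated (bound := B) ?_ ?_ hB ?_
    · exact Filter.Eventually.of_forall fun q => ((continuous_integrand hc hb e k j).comp
        (f := fun a => (q, a)) (by fun_prop)).aestronglyMeasurable
    · filter_upwards [prod_mem_nhds hV hW] with q hq
      exact Filter.Eventually.of_forall (h q.1 hq.1 q.2 hq.2)
    · exact Filter.Eventually.of_forall fun a => ((continuous_integrand hc hb e k j).comp
        (f := fun q => (q, a)) (by fun_prop)).continuousAt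
  differentiableOn := by
    intro y hy
    refine differentiableOn_integral_of_locally_dominated
      (isOpen_lt continuous_const Complex.continuous_re) (fun s _ => ?_) ?_ fun s hs => ?_
    · exact ((continuous_integrand hc hb e k j).comp
        (f := fun a => ((s, y), a)) (by fun_prop)).aestronglyMeasurable
    · refine Filter.Eventually.of_forall fun a => ?_
      unfold integrand
      fun_prop
    · obtain ⟨V, hV, W, hW, B, hB, h⟩ := exists_local_bound hc hb hd j hs hy
      exact ⟨V, hV, B, hB, Filter.Eventually.of_forall fun a s hs =>
        h s hs y (mem_of_mem_nhds hW) a⟩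

end ConeZeta

namespace ConeZeta
variable {ι κ : Type*} [Fintype ι] [Fintype κ] {c : κ → ι → ℝ} {b : ℕ → ℝ → ℝ}

theorem integrand_add_single (e : ι → ℕ) (k j : κ → ℕ) (s : ℂ) (y : κ → ℝ) (a : ι → ℝ) (α : ι) :
    integrand c b (e + Pi.single α 1) k j s y a = Real.exp (a α) * integrand c b e k j s y a := by
  have h : ∑ β, (s + ((e + Pi.single α 1 : ι → ℕ) β : ℕ) : ℂ) * a β = a α + ∑ β, (s + e β) * a β := by
    have h1 : ∀ β, (s + ((e + Pi.single α 1 : ι → ℕ) β : ℕ) : ℂ) * a β =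
        (if β = α then (a β : ℂ) else 0) + (s + e β) * a β := by
      intro β
      by_cases hβ : β = α
      · subst hβ; simp; ring
      · simp [hβ]
    simp only [h1, Finset.sum_add_distrib, Finset.sum_ite_eq', Finset.mem_univ, if_true]
  rw [integrand, integrand, h, Complex.exp_add, Complex.ofReal_exp, mul_assoc]

/-- One factor of the amplitude. -/
def rowFactor (b : ℕ → ℝ → ℝ) (k j : ℕ) (w : ℝ) : ℝ := (w ^ k)⁻¹ * b j w

theorem hasDerivAt_rowFactor (hb : IsDerivTower b) (k j : ℕ) {w : ℝ} (hw : 0 < w) :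
    HasDerivAt (rowFactor b k j) (rowFactor b k (j + 1) w - k * rowFactor b (k + 1) j w) w := by
  have h1 := ((hasDerivAt_pow k w).inv (pow_ne_zero k hw.ne')).mul (hb.hasDerivAt j w hw)
  refine h1.congr_deriv ?_
  simp only [rowFactor, Pi.inv_apply]
  rcases k with _ | k
  · simp
  · simp only [Nat.add_sub_cancel]
    field_simp
    ring

theorem erase_prod_mul_rowFactor (k j k' j' : κ → ℕ) (i : κ) (w : κ → ℝ)
    (h : ∀ l, l ≠ i → k' l = k l ∧ j' l = j l) :
    (∏ l ∈ Finset.univ.erase i, rowFactor b (k l) (j l) (w l)) * rowFactor b (k' i) (j' i) (w i) =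
      ∏ l, rowFactor b (k' l) (j' l) (w l) := by
  rw [← Finset.prod_erase_mul _ _ (Finset.mem_univ i)]
  congr 1
  refine Finset.prod_congr rfl fun l hl => ?_
  obtain ⟨h1, h2⟩ := h l (Finset.ne_of_mem_erase hl)
  rw [h1, h2]

theorem hasLineDerivAt_integrand (hc : IsPairing c) (hb : IsDerivTower b) (e : ι → ℕ)
    (k j : κ → ℕ) (s : ℂ) (y : κ → ℝ) (a v : ι → ℝ) :
    HasLineDerivAt ℝ (integrand c b e k j s y)
      ((∑ α, (s + e α) * v α) * integrand c b e k j s y a +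
        ∑ i, ∑ α, (v α * c i α : ℝ) * (integrand c b (e + Pi.single α 1) k (j + Pi.single i 1) s y a -
          k i * integrand c b (e + Pi.single α 1) (k + Pi.single i 1) j s y a) -
        ∑ α, (v α * colForm c y α : ℝ) * integrand c b (e + Pi.single α 1) k j s y a) a v := by
  have hexp : ∀ α, HasDerivAt (fun t : ℝ => Real.exp ((a + t • v) α)) (v α * Real.exp (a α)) 0 := by
    intro α
    have h : HasDerivAt (fun t : ℝ => (a + t • v) α) (v α) 0 := by
      simpa using ((hasDerivAt_id (0 : ℝ)).mul_const (v α)).const_add (a α)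
    simpa [mul_comm] using h.exp
  have hrow : ∀ i, HasDerivAt (fun t : ℝ => rowForm c i (a + t • v))
      (∑ α, c i α * (v α * Real.exp (a α))) 0 := fun i =>
    HasDerivAt.fun_sum fun α _ => (hexp α).const_mul (c i α)
  have hcol : HasDerivAt (fun t : ℝ => -∑ α, colForm c y α * Real.exp ((a + t • v) α))
      (-∑ α, colForm c y α * (v α * Real.exp (a α))) 0 :=
    (HasDerivAt.fun_sum fun α _ => (hexp α).const_mul (colForm c y α)).neg
  have hprod := HasDerivAt.fun_finsetProd (u := Finset.univ)
    (f := fun i t => rowFactor b (k i) (j i) (rowForm c i (a + t • v))) (x := (0 : ℝ))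
    (f' := fun i => (rowFactor b (k i) (j i + 1) (rowForm c i a) -
      k i * rowFactor b (k i + 1) (j i) (rowForm c i a)) * ∑ α, c i α * (v α * Real.exp (a α)))
    (fun i _ => by
      have h1 := hasDerivAt_rowFactor hb (k i) (j i) (rowForm_pos hc i a)
      have h2 := hrow i
      exact HasDerivAt.comp (h₂ := rowFactor b (k i) (j i)) 0 (by simpa using h1) h2)
  have hlin : HasDerivAt (fun t : ℝ => cexp (∑ α, (s + e α) * ((a + t • v) α : ℝ)))
      (cexp (∑ α, (s + e α) * a α) * ∑ α, (s + e α) * v α) 0 := by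
    have h : HasDerivAt (fun t : ℝ => ∑ α, (s + e α) * ((a + t • v) α : ℝ))
        (∑ α, (s + e α) * v α) 0 := by
      refine HasDerivAt.fun_sum fun α _ => HasDerivAt.const_mul _ ?_
      have h : HasDerivAt (fun t : ℝ => (a + t • v) α) (v α) 0 := by
        simpa using ((hasDerivAt_id (0 : ℝ)).mul_const (v α)).const_add (a α)
      exact h.ofReal_comp
    simpa using h.cexp
  have hmain := hlin.mul (hprod.mul hcol.exp).ofReal_comp
  refine hmain.congr_deriv ?_
  simp only [zero_smul, add_zero, smul_eq_mul, Pi.mul_apply]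
  have hT2 : ∀ i, (∏ l ∈ Finset.univ.erase i, rowFactor b (k l) (j l) (rowForm c l a)) *
      rowFactor b (k i) (j i + 1) (rowForm c i a) =
      ∏ l, rowFactor b (k l) ((j + Pi.single i 1 : κ → ℕ) l) (rowForm c l a) := by
    intro i
    rw [← erase_prod_mul_rowFactor k j k (j + Pi.single i 1) i]
    · simp
    · intro l hl; simp [hl]
  have hT3 : ∀ i, (∏ l ∈ Finset.univ.erase i, rowFactor b (k l) (j l) (rowForm c l a)) *
      rowFactor b (k i + 1) (j i) (rowForm c i a) =
      ∏ l, rowFactor b ((k + Pi.single i 1 : κ → ℕ) l) (j l) (rowForm c l a) := by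
    intro i
    rw [← erase_prod_mul_rowFactor k j (k + Pi.single i 1) j i]
    · simp
    · intro l hl; simp [hl]
  have hsum : ∑ i, (∏ l ∈ Finset.univ.erase i, rowFactor b (k l) (j l) (rowForm c l a)) *
      ((rowFactor b (k i) (j i + 1) (rowForm c i a) -
        k i * rowFactor b (k i + 1) (j i) (rowForm c i a)) * ∑ α, c i α * (v α * Real.exp (a α))) =
      ∑ i, ∑ α, v α * c i α * (Real.exp (a α) *
        ((∏ l, rowFactor b (k l) ((j + Pi.single i 1 : κ → ℕ) l) (rowForm c l a)) -
        k i * ∏ l, rowFactor b ((k + Pi.single i 1 : κ → ℕ) l) (j l) (rowForm c l a))) := by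
    refine Finset.sum_congr rfl fun i _ => ?_
    rw [← hT2, ← hT3, Finset.mul_sum, Finset.mul_sum]
    exact Finset.sum_congr rfl fun α _ => by ring
  rw [hsum]
  simp only [integrand_add_single]
  simp only [integrand, amplitude, ← rowFactor.eq_1]
  push_cast
  simp only [Finset.sum_mul, mul_add, Finset.mul_sum, mul_neg, sub_eq_add_neg]
  rw [add_assoc]
  congr 1
  · exact Finset.sum_congr rfl fun α _ => by ring
  · congr 1
    · exact Finset.sum_congr rfl fun i _ => Finset.sum_congr rfl fun α _ => by ring
    · rw [neg_inj]
      exact Finset.sum_congr rfl fun α _ => by ring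

theorem degree_add_single (e : ι → ℕ) (k : κ → ℕ) (α : ι) (B : Finset ι) :
    degree c (e + Pi.single α 1) k B = degree c e k B + if α ∈ B then 1 else 0 := by
  have h : ∀ β, (((e + Pi.single α 1 : ι → ℕ) β : ℕ) : ℤ) = e β + if β = α then 1 else 0 := by
    intro β
    by_cases hβ : β = α
    · subst hβ; simp
    · simp [hβ]
  simp only [degree, h, Finset.sum_add_distrib, Finset.sum_ite_eq']
  ring

theorem degree_add_single_right (e : ι → ℕ) (k : κ → ℕ) (i : κ) (B : Finset ι) :
    degree c e (k + Pi.single i 1) B = degree c e k B - if rowSupp c i ⊆ B then 1 else 0 := by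
  have h : ∀ l, (((k + Pi.single i 1 : κ → ℕ) l : ℕ) : ℤ) = k l + if l = i then 1 else 0 := by
    intro l
    by_cases hl : l = i
    · subst hl; simp
    · simp [hl]
  simp only [degree, h, Finset.sum_add_distrib, Finset.sum_ite_eq', Finset.mem_filter,
    Finset.mem_univ, true_and]
  ring

theorem degree_le_add_single (e : ι → ℕ) (k : κ → ℕ) (α : ι) (B : Finset ι) :
    degree c e k B ≤ degree c (e + Pi.single α 1) k B := by
  rw [degree_add_single]; split_ifs <;> omega

theorem degree_le_add_single_add_single (e : ι → ℕ) (k : κ → ℕ) {α : ι} {i : κ} (h : c i α ≠ 0)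
    (B : Finset ι) :
    degree c e k B ≤ degree c (e + Pi.single α 1) (k + Pi.single i 1) B := by
  rw [degree_add_single_right, degree_add_single]
  have : rowSupp c i ⊆ B → α ∈ B := fun hB => hB (by simpa [rowSupp] using h)
  split_ifs <;> first | omega | tauto

/-- The coefficient with which `w i` is differentiated in the direction of `A`. -/
def rowCoeff (c : κ → ι → ℝ) (k : κ → ℕ) (A : Finset ι) (i : κ) (α : ι) : ℝ :=
  if rowSupp c i ⊆ A then 0 else k i * c i α

/-- The integrand identity underlying the recursion for Mellin integrals. -/
theorem hasLineDerivAt_integrand_indicator (hc : IsPairing c) (hb : IsDerivTower b) (e : ι → ℕ)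
    (k j : κ → ℕ) (s : ℂ) (y : κ → ℝ) (A : Finset ι) (a : ι → ℝ) :
    HasLineDerivAt ℝ (integrand c b e k j s y)
      ((A.card * s + degree c e k A) * integrand c b e k j s y a +
        ∑ α ∈ A, ∑ i, (c i α : ℂ) * integrand c b (e + Pi.single α 1) k (j + Pi.single i 1) s y a -
        ∑ α ∈ A, ∑ i, (rowCoeff c k A i α : ℂ) *
          integrand c b (e + Pi.single α 1) (k + Pi.single i 1) j s y a -
        ∑ α ∈ A, (colForm c y α : ℂ) * integrand c b (e + Pi.single α 1) k j s y a)
      a (fun α => if α ∈ A then 1 else 0) := by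
  refine (hasLineDerivAt_integrand hc hb e k j s y a _).congr_deriv ?_
  have hrow : ∀ i, rowSupp c i ⊆ A → ∑ α ∈ A, (c i α : ℂ) *
      integrand c b (e + Pi.single α 1) (k + Pi.single i 1) j s y a = integrand c b e k j s y a := by
    intro i hi
    have h1 : ∑ α ∈ A, c i α * Real.exp (a α) = rowForm c i a := by
      refine Finset.sum_subset (Finset.subset_univ A) fun α _ hα => ?_
      have : α ∉ rowSupp c i := fun h => hα (hi h)
      have : c i α = 0 := by simpa [rowSupp] using this
      simp [this]
    simp only [integrand_add_single, ← mul_assoc, ← Finset.sum_mul]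
    have h2 : ∑ α ∈ A, (c i α : ℂ) * (Real.exp (a α) : ℂ) = (rowForm c i a : ℂ) := by
      rw [← h1]; push_cast; rfl
    rw [h2]
    simp only [integrand, amplitude, ← rowFactor.eq_1]
    rw [mul_left_comm, ← Complex.ofReal_mul, ← mul_assoc]
    congr 3
    rw [← Finset.mul_prod_erase _ _ (Finset.mem_univ i), ← Finset.mul_prod_erase _ _ (Finset.mem_univ i),
      ← mul_assoc]
    have hw := (rowForm_pos hc i a).ne'
    congr 1
    · simp only [rowFactor, Pi.add_apply, Pi.single_eq_same]
      field_simp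
      ring
    · refine Finset.prod_congr rfl fun l hl => ?_
      simp [Finset.ne_of_mem_erase hl]
  have hsplit : ∑ i, ∑ α ∈ A, (c i α : ℂ) * ((k i : ℂ) *
      integrand c b (e + Pi.single α 1) (k + Pi.single i 1) j s y a) =
      (∑ i with rowSupp c i ⊆ A, (k i : ℂ)) * integrand c b e k j s y a +
      ∑ α ∈ A, ∑ i, (rowCoeff c k A i α : ℂ) *
          integrand c b (e + Pi.single α 1) (k + Pi.single i 1) j s y a := by
    rw [Finset.sum_comm (s := A), Finset.sum_filter, Finset.sum_mul, ← Finset.sum_add_distrib]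
    refine Finset.sum_congr rfl fun i _ => ?_
    by_cases hi : rowSupp c i ⊆ A
    · simp only [rowCoeff, hi, if_true, Complex.ofReal_zero, zero_mul, Finset.sum_const_zero,
        add_zero]
      rw [← hrow i hi, Finset.mul_sum]
      exact Finset.sum_congr rfl fun α _ => by ring
    · simp only [rowCoeff, hi, if_false, zero_mul, zero_add]
      exact Finset.sum_congr rfl fun α _ => by push_cast; ring
  have hdeg : ∑ α, (s + e α) * ((if α ∈ A then (1 : ℝ) else 0 : ℝ) : ℂ) =
      A.card * s + ∑ α ∈ A, (e α : ℂ) := by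
    have : ∀ α, (s + e α) * ((if α ∈ A then (1 : ℝ) else 0 : ℝ) : ℂ) =
        if α ∈ A then s + e α else 0 := fun α => by split_ifs <;> simp
    simp only [this, Finset.sum_ite_mem, Finset.univ_inter, Finset.sum_add_distrib,
      Finset.sum_const, nsmul_eq_mul]
  have hite : ∀ (f : ι → ℝ) (g : ι → ℂ), ∑ α, (((if α ∈ A then (1 : ℝ) else 0) * f α : ℝ) : ℂ) * g α =
      ∑ α ∈ A, (f α : ℂ) * g α := by
    intro f g
    rw [← Finset.univ_inter A, ← Finset.sum_ite_mem]
    exact Finset.sum_congr rfl fun α _ => by split_ifs <;> simp_all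
  simp only [hite, hdeg, mul_sub, Finset.sum_sub_distrib, hsplit]
  rw [Finset.sum_comm (s := Finset.univ) (t := A)]
  simp only [degree]
  push_cast
  ring

theorem integral_eq_zero_of_hasLineDerivAt {f f' : (ι → ℝ) → ℂ} {v : ι → ℝ}
    (hf : Integrable f) (hf' : Integrable f') (h : ∀ a, HasLineDerivAt ℝ f (f' a) a v) :
    ∫ a, f' a = 0 := by
  have h1 := integral_bilinear_hasLineDerivAt_right_eq_neg_left_of_integrable
    (μ := (volume : Measure (ι → ℝ))) (f := fun _ => (1 : ℂ)) (f' := fun _ => 0) (g := f) (g' := f')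
    (v := v) (B := ContinuousLinearMap.mul ℝ ℂ) (by simp) (by simpa using hf') (by simpa using hf)
    (fun _ _ => hasDerivAt_const _ _) (fun x _ => h x)
  simpa using h1

theorem DegreeGE.mono {N : ℤ} {e e' : ι → ℕ} {k k' : κ → ℕ} (h : DegreeGE c N e k)
    (hle : ∀ B, degree c e k B ≤ degree c e' k' B) : DegreeGE c N e' k' :=
  fun B => (h B).trans (hle B)

/-- The recursion for Mellin integrals that raises the degree in the direction of `A`. -/
theorem mellinInt_recursion (hc : IsPairing c) (hb : IsDerivTower b) {N : ℤ} {e : ι → ℕ}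
    {k : κ → ℕ} (hd : DegreeGE c N e k) (j : κ → ℕ) (A : Finset ι) {s : ℂ} (hs : -(N : ℝ) < s.re)
    {y : κ → ℝ} (hy : ∀ i, 0 < y i) :
    (A.card * s + degree c e k A) * mellinInt c b e k j s y =
      ∑ α ∈ A, ∑ i, (rowCoeff c k A i α : ℂ) *
          mellinInt c b (e + Pi.single α 1) (k + Pi.single i 1) j s y +
      ∑ α ∈ A, (colForm c y α : ℂ) * mellinInt c b (e + Pi.single α 1) k j s y -
      ∑ α ∈ A, ∑ i, (c i α : ℂ) * mellinInt c b (e + Pi.single α 1) k (j + Pi.single i 1) s y := by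
  have i0 := integrable_integrand hc hb hd j hs hy
  have i1 : ∀ α (j : κ → ℕ), Integrable (integrand c b (e + Pi.single α 1) k j s y) := fun α j =>
    integrable_integrand hc hb (hd.mono (degree_le_add_single e k α)) j hs hy
  have i2 : ∀ α i, Integrable fun a => (rowCoeff c k A i α : ℂ) *
      integrand c b (e + Pi.single α 1) (k + Pi.single i 1) j s y a := by
    intro α i
    by_cases h : c i α = 0
    · simp [rowCoeff, h]
    · exact (integrable_integrand hc hb (hd.mono (degree_le_add_single_add_single e k h)) j hs
        hy).const_mul _
  have j0 := i0.const_mul (A.card * s + degree c e k A)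
  have j1 : Integrable fun a => ∑ α ∈ A, ∑ i, (c i α : ℂ) *
      integrand c b (e + Pi.single α 1) k (j + Pi.single i 1) s y a :=
    integrable_finsetSum _ fun α _ => integrable_finsetSum _ fun i _ => (i1 α _).const_mul _
  have j2 : Integrable fun a => ∑ α ∈ A, ∑ i, (rowCoeff c k A i α : ℂ) *
      integrand c b (e + Pi.single α 1) (k + Pi.single i 1) j s y a :=
    integrable_finsetSum _ fun α _ => integrable_finsetSum _ fun i _ => i2 α i
  have j3 : Integrable fun a => ∑ α ∈ A, (colForm c y α : ℂ) *
      integrand c b (e + Pi.single α 1) k j s y a :=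
    integrable_finsetSum _ fun α _ => (i1 α _).const_mul _
  have j01 := j0.add j1
  have j012 := j01.sub j2
  have h := integral_eq_zero_of_hasLineDerivAt i0 (j012.sub j3)
    (hasLineDerivAt_integrand_indicator hc hb e k j s y A)
  have h0 := (integral_sub' j012 j3).symm.trans h
  rw [integral_sub' j01 j2, integral_add' j0 j1, integral_const_mul,
    integral_finsetSum _ fun α _ => integrable_finsetSum _ fun i _ => (i1 α _).const_mul _,
    integral_finsetSum _ fun α _ => integrable_finsetSum _ fun i _ => i2 α i,
    integral_finsetSum _ fun α _ => (i1 α _).const_mul _] at h0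
  simp_rw [integral_finsetSum _ fun i _ => (i1 _ _).const_mul _,
    integral_finsetSum _ fun i _ => i2 _ i, integral_const_mul] at h0
  simp only [mellinInt]
  linear_combination h0

end ConeZeta

namespace ConeZeta
variable {ι κ : Type*}

theorem IsHolomorphicFamily.add {M : ℝ} {f g : ℂ → (κ → ℝ) → ℂ} (hf : IsHolomorphicFamily M f)
    (hg : IsHolomorphicFamily M g) : IsHolomorphicFamily M fun s y => f s y + g s y where
  continuousOn := hf.continuousOn.add hg.continuousOn
  differentiableOn y hy := (hf.differentiableOn y hy).add (hg.differentiableOn y hy)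

theorem IsHolomorphicFamily.mul {M : ℝ} {f g : ℂ → (κ → ℝ) → ℂ} (hf : IsHolomorphicFamily M f)
    (hg : IsHolomorphicFamily M g) : IsHolomorphicFamily M fun s y => f s y * g s y where
  continuousOn := hf.continuousOn.mul hg.continuousOn
  differentiableOn y hy := (hf.differentiableOn y hy).mul (hg.differentiableOn y hy)

theorem isHolomorphicFamily_of_differentiable {M : ℝ} {h : ℂ → ℂ} (hh : Differentiable ℂ h) :
    IsHolomorphicFamily M fun s (_ : κ → ℝ) => h s where
  continuousOn := (hh.continuous.comp continuous_fst).continuousOn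
  differentiableOn _ _ := hh.differentiableOn

theorem isHolomorphicFamily_of_continuous {M : ℝ} {φ : (κ → ℝ) → ℂ} (hφ : Continuous φ) :
    IsHolomorphicFamily M fun _ y => φ y where
  continuousOn := (hφ.comp continuous_snd).continuousOn
  differentiableOn _ _ := differentiableOn_const _

/-- After multiplication by a non-zero polynomial in `s`, the function `f` extends from `1 < re s`
to a holomorphic family on `-M < re s`. -/
def HasContinuation (M : ℝ) (f : ℂ → (κ → ℝ) → ℂ) : Prop :=
  ∃ p : Polynomial ℂ, p ≠ 0 ∧ ∃ g, IsHolomorphicFamily M g ∧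
    ∀ s y, 1 < s.re → (∀ i, 0 < y i) → p.eval s * f s y = g s y

theorem HasContinuation.congr {M : ℝ} {f g : ℂ → (κ → ℝ) → ℂ} (hf : HasContinuation M f)
    (h : ∀ s y, 1 < s.re → (∀ i, 0 < y i) → g s y = f s y) : HasContinuation M g := by
  obtain ⟨p, hp, F, hF, hpF⟩ := hf
  exact ⟨p, hp, F, hF, fun s y hs hy => by rw [h s y hs hy, hpF s y hs hy]⟩

theorem hasContinuation_zero {M : ℝ} : HasContinuation M fun _ (_ : κ → ℝ) => 0 :=
  ⟨1, one_ne_zero, _, isHolomorphicFamily_of_continuous continuous_const, fun _ _ _ _ => mul_zero _⟩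

theorem HasContinuation.add {M : ℝ} {f g : ℂ → (κ → ℝ) → ℂ} (hf : HasContinuation M f)
    (hg : HasContinuation M g) : HasContinuation M fun s y => f s y + g s y := by
  obtain ⟨p, hp, F, hF, hpF⟩ := hf
  obtain ⟨q, hq, G, hG, hqG⟩ := hg
  refine ⟨p * q, mul_ne_zero hp hq, _,
    ((isHolomorphicFamily_of_differentiable q.differentiable).mul hF).add
      ((isHolomorphicFamily_of_differentiable p.differentiable).mul hG), fun s y hs hy => ?_⟩
  rw [← hpF s y hs hy, ← hqG s y hs hy, Polynomial.eval_mul]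
  ring

theorem HasContinuation.continuous_mul {M : ℝ} {f : ℂ → (κ → ℝ) → ℂ} (hf : HasContinuation M f)
    {φ : (κ → ℝ) → ℂ} (hφ : Continuous φ) : HasContinuation M fun s y => φ y * f s y := by
  obtain ⟨p, hp, F, hF, hpF⟩ := hf
  refine ⟨p, hp, _, (isHolomorphicFamily_of_continuous hφ).mul hF, fun s y hs hy => ?_⟩
  rw [← hpF s y hs hy]
  ring

theorem hasContinuation_sum {M : ℝ} {σ : Type*} (t : Finset σ) {f : σ → ℂ → (κ → ℝ) → ℂ}
    (hf : ∀ i ∈ t, HasContinuation M (f i)) : HasContinuation M fun s y => ∑ i ∈ t, f i s y := by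
  induction t using Finset.induction_on with
  | empty => simpa using hasContinuation_zero
  | insert i t hi ih =>
    simp only [Finset.sum_insert hi]
    exact (hf i (Finset.mem_insert_self i t)).add
      (ih fun l hl => hf l (Finset.mem_insert_of_mem hl))

theorem HasContinuation.of_linear_mul {M : ℝ} {f : ℂ → (κ → ℝ) → ℂ} {m d : ℂ} (hm : m ≠ 0)
    (hf : HasContinuation M fun s y => (m * s + d) * f s y) : HasContinuation M f := by
  obtain ⟨p, hp, F, hF, hpF⟩ := hf
  refine ⟨p * (Polynomial.C m * Polynomial.X + Polynomial.C d), mul_ne_zero hp fun h => hm ?_, F, hF,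
    fun s y hs hy => ?_⟩
  · simpa using congrArg (fun q => Polynomial.coeff q 1) h
  · rw [← hpF s y hs hy]
    simp only [Polynomial.eval_mul, Polynomial.eval_add, Polynomial.eval_C, Polynomial.eval_X]
    ring

variable [Fintype ι] [Fintype κ] {c : κ → ι → ℝ} {b : ℕ → ℝ → ℝ}

/-- The total amount by which the scaling degrees fall short of `N` per variable. -/
def deficit (c : κ → ι → ℝ) (N : ℤ) (e : ι → ℕ) (k : κ → ℕ) : ℕ :=
  ∑ A : Finset ι, (N * A.card - degree c e k A).toNat

theorem deficit_lt {N : ℤ} {e e' : ι → ℕ} {k k' : κ → ℕ}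
    (hle : ∀ B, degree c e k B ≤ degree c e' k' B) {A : Finset ι}
    (hlt : degree c e k A < N * A.card) (hA : degree c e k A < degree c e' k' A) :
    deficit c N e' k' < deficit c N e k := by
  refine Finset.sum_lt_sum (fun B _ => ?_) ⟨A, Finset.mem_univ A, ?_⟩
  · have := hle B
    omega
  · omega

/-- Mellin integrals of initial degree at least `-1` per variable admit a continuation. -/
theorem hasContinuation_mellinInt (hc : IsPairing c) (hb : IsDerivTower b) (N : ℤ) {e : ι → ℕ}
    {k : κ → ℕ} (hd : DegreeGE c (-1) e k) (j : κ → ℕ) :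
    HasContinuation N (mellinInt c b e k j) := by
  induction hn : deficit c N e k using Nat.strong_induction_on generalizing e k j with
  | _ n ih =>
  by_cases hN : DegreeGE c N e k
  · exact ⟨1, one_ne_zero, _, isHolomorphicFamily_mellinInt hc hb hN j, fun s y _ _ => by simp⟩
  obtain ⟨A, hA⟩ : ∃ A : Finset ι, degree c e k A < N * A.card := by
    simpa [DegreeGE] using hN
  have hA0 : A.card ≠ 0 := by
    intro h
    have := hd A
    rw [h] at hA this
    simp only [Nat.cast_zero, mul_zero] at hA this
    omega
  have hstep : ∀ α ∈ A, ∀ j, HasContinuation N (mellinInt c b (e + Pi.single α 1) k j) := by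
    intro α hα j
    have hle := degree_le_add_single (c := c) e k α
    refine ih _ (hn ▸ deficit_lt hle hA ?_) (hd.mono hle) j rfl
    rw [degree_add_single, if_pos hα]
    omega
  have hstep' : ∀ α ∈ A, ∀ i, HasContinuation N fun s y => (rowCoeff c k A i α : ℂ) *
      mellinInt c b (e + Pi.single α 1) (k + Pi.single i 1) j s y := by
    intro α hα i
    by_cases h0 : rowCoeff c k A i α = 0
    · simpa [h0] using hasContinuation_zero
    simp only [rowCoeff, ite_eq_left_iff, not_forall, mul_eq_zero, not_or] at h0
    obtain ⟨hi, -, hcα⟩ := h0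
    have hle := degree_le_add_single_add_single (c := c) e k hcα
    refine HasContinuation.continuous_mul ?_ continuous_const
    refine ih _ (hn ▸ deficit_lt hle hA ?_) (hd.mono hle) j rfl
    rw [degree_add_single_right, degree_add_single, if_pos hα, if_neg hi]
    omega
  refine HasContinuation.of_linear_mul (m := A.card) (d := degree c e k A) (by exact_mod_cast hA0) ?_
  have h1 := hasContinuation_sum A fun α hα =>
    hasContinuation_sum Finset.univ fun i _ => hstep' α hα i
  have h2 := hasContinuation_sum A fun α hα => (hstep α hα j).continuous_mul
    (Complex.continuous_ofReal.comp (continuous_colForm (c := c) α))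
  have h3 := hasContinuation_sum A fun α hα => hasContinuation_sum Finset.univ fun i _ =>
    (hstep α hα (j + Pi.single i 1)).continuous_mul (φ := fun _ => -(c i α : ℂ)) continuous_const
  refine ((h1.add h2).add h3).congr fun s y hs hy => ?_
  rw [mellinInt_recursion hc hb hd j A (by simpa using hs) hy]
  simp only [neg_mul, Finset.sum_neg_distrib, Function.comp_apply]
  ring

end ConeZeta

/-- The entire function `(1 - exp (-z)) / z`. -/
def expSlope : ℂ → ℂ := dslope (fun z => 1 - cexp (-z)) 0

theorem expSlope_of_ne {z : ℂ} (hz : z ≠ 0) : expSlope z = (1 - cexp (-z)) / z := by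
  rw [expSlope, dslope_of_ne _ hz, slope_def_field]
  simp

theorem differentiable_expSlope : Differentiable ℂ expSlope := by
  have h := (Complex.differentiableOn_dslope (f := fun z : ℂ => 1 - cexp (-z)) (c := 0)
    (s := Set.univ) Filter.univ_mem).2 (by fun_prop)
  exact differentiableOn_univ.1 h

theorem expSlope_ne_zero {z : ℂ} (hz : |z.im| < 2) : expSlope z ≠ 0 := by
  by_cases h0 : z = 0
  · subst h0
    have h : HasDerivAt (fun z : ℂ => 1 - cexp (-z)) 1 0 := by
      simpa using ((hasDerivAt_neg (0 : ℂ)).cexp).const_sub 1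
    rw [expSlope, dslope_same, h.deriv]
    exact one_ne_zero
  · rw [expSlope_of_ne h0]
    refine div_ne_zero (fun h => ?_) h0
    obtain ⟨n, hn⟩ := Complex.exp_eq_one_iff.1 (sub_eq_zero.1 h).symm
    have him : -z.im = n * (2 * Real.pi) := by simpa using congrArg Complex.im hn
    have hpi := Real.pi_gt_three
    have hn0 : n = 0 := by
      by_contra hne
      have h1 : (1 : ℝ) ≤ |(n : ℝ)| := by exact_mod_cast Int.one_le_abs hne
      have h2 : |z.im| = |(n : ℝ)| * (2 * Real.pi) := by
        rw [← abs_neg, him, abs_mul, abs_of_pos (by positivity : 0 < 2 * Real.pi)]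
      nlinarith
    subst hn0
    exact h0 (by simpa using hn)

/-- The derivatives of `w / (1 - exp (-w))`. -/
def toddDeriv (j : ℕ) (w : ℝ) : ℝ := (iteratedDeriv j (fun z => (expSlope z)⁻¹) (w : ℂ)).re

theorem toddDeriv_zero {w : ℝ} (hw : 0 < w) : toddDeriv 0 w = w / (1 - Real.exp (-w)) := by
  rw [toddDeriv, iteratedDeriv_zero, expSlope_of_ne (by exact_mod_cast hw.ne'), inv_div]
  have : (w : ℂ) / (1 - cexp (-w)) = ((w / (1 - Real.exp (-w)) : ℝ) : ℂ) := by push_cast; rfl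
  rw [this, Complex.ofReal_re]

theorem differentiableOn_expSlope_inv :
    DifferentiableOn ℂ (fun z => (expSlope z)⁻¹) {z | |z.im| < 2} :=
  differentiable_expSlope.differentiableOn.inv fun _ hz => expSlope_ne_zero hz

theorem isOpen_abs_im_lt : IsOpen {z : ℂ | |z.im| < 2} :=
  isOpen_lt (by fun_prop) continuous_const

theorem closedBall_subset_abs_im_lt (w : ℝ) : Metric.closedBall (w : ℂ) 1 ⊆ {z | |z.im| < 2} := by
  intro z hz
  have h := (Complex.abs_im_le_norm (z - w)).trans (mem_closedBall_iff_norm.1 hz)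
  simp only [Complex.sub_im, Complex.ofReal_im, sub_zero] at h
  exact h.trans_lt one_lt_two

theorem exists_norm_expSlope_inv_le : ∃ C : ℝ, 0 ≤ C ∧ ∀ w : ℝ, 0 < w →
    ∀ z ∈ Metric.closedBall (w : ℂ) 1, ‖(expSlope z)⁻¹‖ ≤ C * (1 + w) := by
  obtain ⟨C, hC⟩ := ((isCompact_closedBall (0 : ℂ) 5).inter_right
    (isClosed_le (by fun_prop) continuous_const : IsClosed {z : ℂ | |z.im| ≤ 1})).exists_bound_of_continuousOn
    (differentiableOn_expSlope_inv.continuousOn.mono fun z hz => show |z.im| < 2 from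
      lt_of_le_of_lt hz.2 one_lt_two)
  refine ⟨max C 2, le_max_of_le_right zero_le_two, fun w hw z hz => ?_⟩
  have hz1 : ‖z - w‖ ≤ 1 := mem_closedBall_iff_norm.1 hz
  have hz2 : ‖z‖ ≤ 1 + w := by
    have h := norm_add_le (z - w) w
    rw [sub_add_cancel, Complex.norm_real, Real.norm_of_nonneg hw.le] at h
    linarith
  rcases le_total w 4 with h4 | h4
  · have him : |z.im| ≤ 1 := by
      simpa using (Complex.abs_im_le_norm (z - w)).trans hz1
    refine (hC z ⟨?_, him⟩).trans ?_
    · simpa using hz2.trans (by linarith)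
    · nlinarith [le_max_left C 2, le_max_right C 2]
  · have hre : 1 ≤ z.re := by
      have := (abs_le.1 ((Complex.abs_re_le_norm (z - w)).trans hz1)).1
      simp at this
      linarith
    have hz0 : z ≠ 0 := fun h => by simp [h] at hre; linarith
    rw [expSlope_of_ne hz0, inv_div, norm_div]
    have h1 : 1 / 2 ≤ ‖1 - cexp (-z)‖ := by
      have h2 : ‖cexp (-z)‖ ≤ 1 / 2 := by
        rw [Complex.norm_exp, Complex.neg_re]
        have := Real.exp_le_exp.2 (neg_le_neg hre)
        have := Real.exp_neg_one_lt_d9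
        linarith
      have h3 := norm_sub_norm_le 1 (cexp (-z))
      rw [norm_one] at h3
      linarith
    rw [div_le_iff₀ (by linarith)]
    have := mul_le_mul (le_max_right C 2) h1 (by norm_num) (by positivity)
    nlinarith [norm_nonneg z]

theorem isDerivTower_toddDeriv : IsDerivTower toddDeriv where
  hasDerivAt j w _ := by
    have han : AnalyticAt ℂ (fun z => (expSlope z)⁻¹) (w : ℂ) :=
      differentiableOn_expSlope_inv.analyticAt (isOpen_abs_im_lt.mem_nhds (by simp))
    have h := (han.iterated_deriv j).differentiableAt.hasDerivAt
    rw [← iteratedDeriv_eq_iterate, ← iteratedDeriv_succ] at h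
    exact h.real_of_complex
  bound j δ hδ := by
    obtain ⟨C, hC0, hC⟩ := exists_norm_expSlope_inv_le
    refine ⟨j.factorial * C * (1 + δ⁻¹), by positivity, fun w hw => ?_⟩
    have h1 : ‖iteratedDeriv j (fun z => (expSlope z)⁻¹) (w : ℂ)‖ ≤
        j.factorial * (C * (1 + w)) / 1 ^ j := by
      refine Complex.norm_iteratedDeriv_le_of_forall_mem_sphere_norm_le j one_pos ?_ fun z hz =>
        hC w hw z (Metric.sphere_subset_closedBall hz)
      exact (differentiableOn_expSlope_inv.mono (closedBall_subset_abs_im_lt w)).diffContOnCl_ball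
        subset_rfl
    refine (Complex.abs_re_le_norm _).trans (h1.trans ?_)
    rw [one_pow, div_one, mul_assoc, mul_assoc]
    refine mul_le_mul_of_nonneg_left (mul_le_mul_of_nonneg_left ?_ hC0) (by positivity)
    have h2 := Real.add_one_le_exp (δ * w)
    have h3 : 1 ≤ Real.exp (δ * w) := Real.one_le_exp (by positivity)
    have h4 : w ≤ δ⁻¹ * Real.exp (δ * w) := by
      rw [inv_mul_eq_div, le_div_iff₀ hδ]
      linarith
    linarith

namespace ConeZeta
variable {ι κ : Type*} [Fintype ι] [Fintype κ] {c : κ → ι → ℝ}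

/-- The kernel of the Mellin transform of `∏ α, (colForm c y α) ^ (-s)`. -/
def kernel (c : κ → ι → ℝ) (s : ℂ) (y : κ → ℝ) (a : ι → ℝ) : ℂ :=
  cexp (∑ α, s * a α) * (Real.exp (-∑ α, colForm c y α * Real.exp (a α)) : ℂ)

theorem integral_kernel (hc : IsPairing c) {s : ℂ} (hs : 0 < s.re) {y : κ → ℝ}
    (hy : ∀ i, 0 < y i) :
    ∫ a, kernel c s y a = Gamma s ^ Fintype.card ι * ∏ α, (colForm c y α : ℂ) ^ (-s) := by
  have h : ∀ a, kernel c s y a =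
      ∏ α, cexp (s * a α) * (Real.exp (-(colForm c y α * Real.exp (a α))) : ℂ) := by
    intro a
    rw [kernel, Complex.exp_sum, ← Finset.sum_neg_distrib, Real.exp_sum, Complex.ofReal_prod,
      Finset.prod_mul_distrib]
  simp only [h]
  rw [integral_fintype_prod_volume_eq_prod
    (fun α (t : ℝ) => cexp (s * t) * (Real.exp (-(colForm c y α * Real.exp t)) : ℂ))]
  simp only [integral_cexp_mul_exp_neg_mul_exp hs (colForm_pos hc hy _), Finset.prod_mul_distrib,
    Finset.prod_const, Finset.card_univ]
  ring

theorem kernel_add (s : ℂ) (y z : κ → ℝ) (a : ι → ℝ) :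
    kernel c s (y + z) a = kernel c s y a * ∏ i, (Real.exp (-(z i * rowForm c i a)) : ℂ) := by
  have h : ∑ α, colForm c (y + z) α * Real.exp (a α) =
      ∑ α, colForm c y α * Real.exp (a α) + ∑ i, z i * rowForm c i a := by
    simp only [colForm, rowForm, Pi.add_apply, add_mul, Finset.sum_add_distrib, Finset.sum_mul,
      Finset.mul_sum]
    rw [Finset.sum_comm (s := Finset.univ (α := κ)) (t := Finset.univ (α := ι))
      (f := fun i α => z i * (c i α * Real.exp (a α)))]
    congr 1
    exact Finset.sum_congr rfl fun α _ => Finset.sum_congr rfl fun i _ => by ring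
  rw [kernel, kernel, h, neg_add, Real.exp_add, ← Finset.sum_neg_distrib (f := fun i => z i * _),
    Real.exp_sum, Complex.ofReal_mul, Complex.ofReal_prod]
  ring

theorem continuous_kernel (s : ℂ) (y : κ → ℝ) : Continuous (kernel c s y) := by
  unfold kernel; fun_prop

theorem integrable_and_integral_kernel_add (hc : IsPairing c) {X : Type*} [MeasurableSpace X]
    {ν : Measure X} [SigmaFinite ν] {φ : X → ℝ} (hφ : Measurable φ) {G : ℝ → ℝ}
    (hint : ∀ w, 0 < w → Integrable (fun t => Real.exp (-(φ t * w))) ν)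
    (hG : ∀ w, 0 < w → ∫ t, Real.exp (-(φ t * w)) ∂ν = G w) {ρ : (ι → ℝ) → ℂ} (hρ : Measurable ρ)
    {s : ℂ} {y : κ → ℝ}
    (hI : Integrable fun a => kernel c s y a * ρ a * ∏ i, (G (rowForm c i a) : ℂ)) :
    Integrable (fun t : κ → X => ∫ a, kernel c s (y + fun i => φ (t i)) a * ρ a)
      (Measure.pi fun _ => ν) ∧
    ∫ t : κ → X, (∫ a, kernel c s (y + fun i => φ (t i)) a * ρ a) ∂(Measure.pi fun _ => ν) =
      ∫ a, kernel c s y a * ρ a * ∏ i, (G (rowForm c i a) : ℂ) := by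
  have hker : ∀ (t : κ → X) a, kernel c s (y + fun i => φ (t i)) a * ρ a =
      kernel c s y a * ρ a * ∏ i, (Real.exp (-(φ (t i) * rowForm c i a)) : ℂ) := fun t a => by
    rw [kernel_add]; ring
  simp only [hker]
  have hpi : ∀ a, Integrable (fun t : κ → X =>
      ∏ i, (Real.exp (-(φ (t i) * rowForm c i a)) : ℂ)) (Measure.pi fun _ => ν) := fun a =>
    Integrable.fintype_prod (f := fun i t => (Real.exp (-(φ t * rowForm c i a)) : ℂ))
      fun i => (hint _ (rowForm_pos hc i a)).ofReal
  have hprod : Integrable (Function.uncurry fun (t : κ → X) (a : ι → ℝ) =>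
      kernel c s y a * ρ a * ∏ i, (Real.exp (-(φ (t i) * rowForm c i a)) : ℂ))
      ((Measure.pi fun _ => ν).prod volume) := by
    refine (integrable_prod_iff' (Measurable.aestronglyMeasurable ?_)).2 ⟨?_, ?_⟩
    · have h1 : ∀ i, Measurable (rowForm c i) := fun i => (continuous_rowForm i).measurable
      have h2 := (continuous_kernel (c := c) s y).measurable
      have h3 : ∀ i, Measurable fun q : (κ → X) × (ι → ℝ) =>
          (Real.exp (-(φ (q.1 i) * rowForm c i q.2)) : ℂ) := fun i => by fun_prop
      exact ((h2.comp measurable_snd).mul (hρ.comp measurable_snd)).mul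
        (Finset.measurable_fun_prod _ fun i _ => h3 i)
    · exact Filter.Eventually.of_forall fun a => (hpi a).const_mul (kernel c s y a * ρ a)
    · refine hI.norm.congr (Filter.Eventually.of_forall fun a => ?_)
      simp only [Function.uncurry_apply_pair, norm_mul, norm_prod, Complex.norm_real,
        Real.norm_eq_abs, Real.abs_exp]
      rw [integral_const_mul,
        integral_fintype_prod_eq_prod (𝕜 := ℝ) fun i t => Real.exp (-(φ t * rowForm c i a))]
      congr 1
      refine Finset.prod_congr rfl fun i _ => ?_
      rw [hG _ (rowForm_pos hc i a), abs_of_nonneg]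
      rw [← hG _ (rowForm_pos hc i a)]
      exact integral_nonneg fun t => (Real.exp_pos _).le
  refine ⟨hprod.integral_prod_left, ?_⟩
  rw [integral_integral_swap hprod]
  refine integral_congr_ae (Filter.Eventually.of_forall fun a => ?_)
  simp only
  rw [integral_const_mul,
    integral_fintype_prod_eq_prod (fun i t => (Real.exp (-(φ t * rowForm c i a)) : ℂ))]
  congr 1
  refine Finset.prod_congr rfl fun i _ => ?_
  rw [integral_complex_ofReal, hG _ (rowForm_pos hc i a)]

theorem integrand_one (hc : IsPairing c) (s : ℂ) (y : κ → ℝ) (a : ι → ℝ) :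
    integrand c toddDeriv 0 1 0 s y a =
      kernel c s y a * ∏ i, (((1 - Real.exp (-rowForm c i a))⁻¹ : ℝ) : ℂ) := by
  have h : ∀ i, (rowForm c i a ^ (1 : κ → ℕ) i)⁻¹ * toddDeriv ((0 : κ → ℕ) i) (rowForm c i a) =
      (1 - Real.exp (-rowForm c i a))⁻¹ := by
    intro i
    have hw := rowForm_pos hc i a
    rw [Pi.zero_apply, toddDeriv_zero hw, Pi.one_apply, pow_one, div_eq_mul_inv, ← mul_assoc,
      inv_mul_cancel₀ hw.ne', one_mul]
  rw [integrand, amplitude, Finset.prod_congr rfl fun i _ => h i, kernel]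
  simp only [Pi.zero_apply, Nat.cast_zero, add_zero]
  push_cast
  ring

theorem prod_colForm_identity {ι κ : Type*} [Fintype ι] [Fintype κ] {c : κ → ι → ℝ}
    (hc : IsPairing c) {X : Type*} [MeasurableSpace X]
    {ν : Measure X} [SigmaFinite ν] {φ : X → ℝ} (hφ : Measurable φ) (hφ0 : ∀ᵐ t ∂ν, 0 ≤ φ t)
    {G : ℝ → ℝ} (hint : ∀ w, 0 < w → Integrable (fun t => Real.exp (-(φ t * w))) ν)
    (hG : ∀ w, 0 < w → ∫ t, Real.exp (-(φ t * w)) ∂ν = G w)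
    {s : ℂ} (hs : 0 < s.re) {y : κ → ℝ} (hy : ∀ i, 0 < y i)
    (hI : Integrable fun a => kernel c s y a * ∏ i, (G (rowForm c i a) : ℂ)) :
    Integrable (fun t : κ → X => ∏ α, (colForm c (y + fun i => φ (t i)) α : ℂ) ^ (-s))
      (Measure.pi fun _ => ν) ∧
    Gamma s ^ Fintype.card ι * ∫ t : κ → X, ∏ α, (colForm c (y + fun i => φ (t i)) α : ℂ) ^ (-s)
      ∂(Measure.pi fun _ => ν) = ∫ a, kernel c s y a * ∏ i, (G (rowForm c i a) : ℂ) := by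
  have h := integrable_and_integral_kernel_add hc hφ hint hG (ρ := fun _ => 1) measurable_const
    (s := s) (y := y) (by simpa using hI)
  simp only [mul_one] at h
  have hae : ∀ᵐ t ∂(Measure.pi fun _ : κ => ν), ∀ i, 0 ≤ φ (t i) :=
    ae_all_iff.2 fun i => (Measure.tendsto_eval_ae_ae (μ := fun _ : κ => ν) (i := i)).eventually hφ0
  have heq : (fun t : κ → X => ∫ a, kernel c s (y + fun i => φ (t i)) a) =ᵐ[Measure.pi fun _ => ν]
      fun t => Gamma s ^ Fintype.card ι *
        ∏ α, (colForm c (y + fun i => φ (t i)) α : ℂ) ^ (-s) := by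
    filter_upwards [hae] with t ht
    exact integral_kernel hc hs fun i => add_pos_of_pos_of_nonneg (hy i) (ht i)
  have hΓ : Gamma s ^ Fintype.card ι ≠ 0 := pow_ne_zero _ (Gamma_ne_zero_of_re_pos hs)
  refine ⟨?_, ?_⟩
  · have h1 := (h.1.congr heq).const_mul (Gamma s ^ Fintype.card ι)⁻¹
    simpa only [inv_mul_cancel_left₀ hΓ] using h1
  · rw [← h.2, integral_congr_ae heq, integral_const_mul]

end ConeZeta

namespace ConeZeta

theorem pi_count (κ : Type*) [Fintype κ] :
    Measure.pi (fun _ : κ => (Measure.count : Measure ℕ)) = Measure.count :=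
  Measure.ext_iff_singleton.2 fun f => by simp [Measure.pi_singleton]

theorem hasSum_exp_neg_nat_mul {w : ℝ} (hw : 0 < w) :
    HasSum (fun n : ℕ => Real.exp (-(n * w))) (1 - Real.exp (-w))⁻¹ := by
  have h := hasSum_geometric_of_lt_one (Real.exp_pos (-w)).le (Real.exp_lt_one_iff.2 (neg_lt_zero.2 hw))
  refine h.congr_fun fun n => ?_
  rw [← Real.exp_nat_mul, mul_neg]

theorem integrable_exp_neg_mul_count {w : ℝ} (hw : 0 < w) :
    Integrable (fun n : ℕ => Real.exp (-((n : ℝ) * w))) Measure.count := by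
  rw [integrable_count_iff]
  simpa using (hasSum_exp_neg_nat_mul hw).summable

theorem integral_exp_neg_mul_count {w : ℝ} (hw : 0 < w) :
    ∫ n : ℕ, Real.exp (-((n : ℝ) * w)) ∂Measure.count = (1 - Real.exp (-w))⁻¹ := by
  rw [integral_countable (integrable_exp_neg_mul_count hw)]
  simpa [Measure.real] using (hasSum_exp_neg_nat_mul hw).tsum_eq

theorem integrable_exp_neg_mul_Ioi {w : ℝ} (hw : 0 < w) :
    Integrable (fun t : ℝ => Real.exp (-(t * w))) (volume.restrict (Set.Ioi 0)) :=
  (integrableOn_exp_mul_Ioi (neg_lt_zero.2 hw) 0).congr_fun (fun t _ => by ring_nf)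
    measurableSet_Ioi

theorem integral_exp_neg_mul_Ioi {w : ℝ} (hw : 0 < w) :
    ∫ t in Set.Ioi (0 : ℝ), Real.exp (-(t * w)) = w⁻¹ := by
  have h := integral_exp_mul_Ioi (neg_lt_zero.2 hw) 0
  rw [mul_zero, Real.exp_zero, neg_div_neg_eq, one_div] at h
  rw [← h]
  exact integral_congr_ae (Filter.Eventually.of_forall fun t => by ring_nf)

theorem integrable_exp_neg_mul_Icc (w : ℝ) :
    Integrable (fun t : ℝ => Real.exp (-(t * w))) (volume.restrict (Set.Icc 0 1)) :=
  (Continuous.continuousOn (by fun_prop)).integrableOn_compact isCompact_Icc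

theorem integral_exp_neg_mul_Icc {w : ℝ} (hw : 0 < w) :
    ∫ t in Set.Icc (0 : ℝ) 1, Real.exp (-(t * w)) = (1 - Real.exp (-w)) * w⁻¹ := by
  rw [integral_Icc_eq_integral_Ioc, ← intervalIntegral.integral_of_le zero_le_one]
  have h : ∀ t ∈ Set.uIcc (0 : ℝ) 1,
      HasDerivAt (fun t => -(Real.exp (-(t * w)) * w⁻¹)) (Real.exp (-(t * w))) t := by
    intro t _
    have h1 := ((((hasDerivAt_id t).mul_const w).neg.exp).mul_const w⁻¹).neg
    refine h1.congr_deriv ?_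
    simp only [id, Pi.neg_apply]
    field_simp
  rw [intervalIntegral.integral_eq_sub_of_hasDerivAt h
    (Continuous.intervalIntegrable (by fun_prop) _ _)]
  simp
  ring

variable {ι κ : Type*} [Fintype ι] [Fintype κ] {c : κ → ι → ℝ}

theorem tsum_prod_colForm (hc : IsPairing c) (hd : DegreeGE c (-1) 0 1) {s : ℂ} (hs : 1 < s.re)
    {y : κ → ℝ} (hy : ∀ i, 0 < y i) :
    Gamma s ^ Fintype.card ι *
      ∑' m : κ → ℕ, ∏ α, (colForm c (y + fun i => (m i : ℝ)) α : ℂ) ^ (-s) =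
      mellinInt c toddDeriv 0 1 0 s y := by
  have hI := integrable_integrand hc isDerivTower_toddDeriv hd 0 (s := s) (by simpa using hs) hy
  rw [funext (integrand_one hc s y)] at hI
  have h := prod_colForm_identity hc (φ := fun n : ℕ => (n : ℝ)) (ν := Measure.count)
    (measurable_from_nat) (Filter.Eventually.of_forall fun n => n.cast_nonneg)
    (fun w hw => integrable_exp_neg_mul_count hw) (fun w hw => integral_exp_neg_mul_count hw)
    (zero_lt_one.trans hs) hy hI
  rw [pi_count] at h
  rw [integral_countable h.1] at h
  simp only [Measure.real, Measure.count_singleton, ENNReal.toReal_one, one_smul] at h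
  rw [h.2, mellinInt]
  simp only [integrand_one hc]

theorem integral_prod_colForm (hc : IsPairing c) (hd : DegreeGE c (-1) 0 1) {s : ℂ}
    (hs : 1 < s.re) {y : κ → ℝ} (hy : ∀ i, 0 < y i) :
    Gamma s ^ Fintype.card ι *
      ∫ t in {t : κ → ℝ | ∀ i, 0 < t i}, ∏ α, (colForm c (y + t) α : ℂ) ^ (-s) =
      ∫ t in Set.Icc (0 : κ → ℝ) 1, mellinInt c toddDeriv 0 1 0 s (y + t) := by
  have hI := integrable_integrand hc isDerivTower_toddDeriv hd 0 (s := s) (by simpa using hs) hy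
  rw [funext (integrand_one hc s y)] at hI
  have hrow : ∀ i, Measurable (rowForm c i) := fun i => (continuous_rowForm i).measurable
  have hker := (continuous_kernel (c := c) s y).measurable
  have hexp : ∀ i a, 0 < 1 - Real.exp (-rowForm c i a) := fun i a =>
    sub_pos.2 (Real.exp_lt_one_iff.2 (neg_lt_zero.2 (rowForm_pos hc i a)))
  have hI' : Integrable fun a => kernel c s y a * ∏ i, (((rowForm c i a)⁻¹ : ℝ) : ℂ) := by
    refine hI.mono (hker.mul (Finset.measurable_fun_prod _ fun i _ => ?_)).aestronglyMeasurable
      (Filter.Eventually.of_forall fun a => ?_)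
    · exact Complex.measurable_ofReal.comp (hrow i).inv
    · simp only [norm_mul, norm_prod, Complex.norm_real]
      refine mul_le_mul_of_nonneg_left (Finset.prod_le_prod (fun i _ => norm_nonneg _) fun i _ => ?_)
        (norm_nonneg _)
      have hw := rowForm_pos hc i a
      rw [Real.norm_of_nonneg (inv_pos.2 hw).le, Real.norm_of_nonneg (inv_pos.2 (hexp i a)).le]
      refine inv_anti₀ (hexp i a) ?_
      linarith [Real.add_one_le_exp (-rowForm c i a)]
  have h := prod_colForm_identity hc (φ := fun t : ℝ => t) (ν := volume.restrict (Set.Ioi 0))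
    measurable_id ((ae_restrict_mem measurableSet_Ioi).mono fun t ht => le_of_lt ht)
    (fun w hw => integrable_exp_neg_mul_Ioi hw) (fun w hw => integral_exp_neg_mul_Ioi hw)
    (zero_lt_one.trans hs) hy hI'
  have hset : {t : κ → ℝ | ∀ i, 0 < t i} = Set.univ.pi fun _ => Set.Ioi 0 := by ext; simp
  have hker' : ∀ a, kernel c s y a * ∏ i, (((rowForm c i a)⁻¹ : ℝ) : ℂ) =
      kernel c s y a * (∏ i, (((1 - Real.exp (-rowForm c i a))⁻¹ : ℝ) : ℂ)) *
        ∏ i, (((1 - Real.exp (-rowForm c i a)) * (rowForm c i a)⁻¹ : ℝ) : ℂ) := by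
    intro a
    rw [mul_assoc, ← Finset.prod_mul_distrib]
    congr 1
    refine Finset.prod_congr rfl fun i _ => ?_
    rw [← Complex.ofReal_mul, inv_mul_cancel_left₀ (hexp i a).ne']
  simp only [hker'] at h hI'
  have h' := integrable_and_integral_kernel_add hc (φ := fun t : ℝ => t)
    (ν := volume.restrict (Set.Icc 0 1)) measurable_id
    (fun w _ => integrable_exp_neg_mul_Icc w) (fun w hw => integral_exp_neg_mul_Icc hw)
    (ρ := fun a => ∏ i, (((1 - Real.exp (-rowForm c i a))⁻¹ : ℝ) : ℂ))
    (Finset.measurable_fun_prod _ fun i _ => by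
      have := hrow i
      fun_prop) hI'
  rw [hset, volume_pi, Measure.restrict_pi_pi, h.2, ← h'.2, ← Measure.restrict_pi_pi,
    Set.pi_univ_Icc]
  simp only [mellinInt, integrand_one hc]
  rfl

end ConeZeta

open Topology in
/-- A meromorphic function that is analytic at `z₀` and coincides on a right half-plane with a
quotient `f / p` is at `z₀` given by Cauchy's formula for `f / p`. -/
theorem eval_eq_circleIntegral_of_mul_eq {M R : ℝ} {z₀ : ℂ} {ε : ℝ} (hε : 0 < ε)
    (hball : Metric.closedBall z₀ ε ⊆ {s | -M < s.re}) {p f F : ℂ → ℂ} (hp : Differentiable ℂ p)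
    (hp0 : ∀ z ∈ Metric.closedBall z₀ ε, z ≠ z₀ → p z ≠ 0)
    (hf : DifferentiableOn ℂ f {s | -M < s.re}) (hF : MeromorphicOn F Set.univ)
    (hF0 : AnalyticAt ℂ F z₀) (hpF : ∀ s : ℂ, R < s.re → p s * F s = f s) :
    F z₀ = (2 * Real.pi * I)⁻¹ * ∮ z in C(z₀, ε), (z - z₀)⁻¹ * (f z / p z) := by
  have hU : IsOpen {s : ℂ | -M < s.re} := isOpen_lt continuous_const Complex.continuous_re
  have hmer : MeromorphicOn (fun z => p z * F z - f z) {s | -M < s.re} := fun z hz =>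
    ((hp.analyticAt z).meromorphicAt.mul (hF z (Set.mem_univ z))).sub
      (hf.analyticAt (hU.mem_nhds hz)).meromorphicAt
  have hz₀ : z₀ ∈ {s : ℂ | -M < s.re} := hball (Metric.mem_closedBall_self hε.le)
  have hev : ∀ᶠ z in 𝓝[≠] z₀, p z * F z - f z = 0 := by
    rw [← meromorphicOrderAt_eq_top_iff]
    by_contra hne
    obtain ⟨x, hxM, hxR⟩ : ∃ x : ℝ, -M < x ∧ R < x :=
      ⟨max (-M) R + 1, (le_max_left _ _).trans_lt (lt_add_one _),
        (le_max_right _ _).trans_lt (lt_add_one _)⟩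
    refine hmer.meromorphicOrderAt_ne_top_of_isPreconnected (y := (x : ℂ))
      (convex_halfSpace_re_gt (-M)).isPreconnected hz₀ (by simpa using hxM) hne ?_
    rw [meromorphicOrderAt_eq_top_iff]
    refine Filter.Eventually.filter_mono nhdsWithin_le_nhds ?_
    filter_upwards [(isOpen_lt continuous_const Complex.continuous_re :
      IsOpen {s : ℂ | R < s.re}).mem_nhds (by simpa using hxR : (x : ℂ) ∈ {s : ℂ | R < s.re})]
      with s hs
    rw [hpF s hs, sub_self]
  let g : ℂ → ℂ := Function.update (fun z => f z / p z) z₀ (F z₀)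
  have hgF : g =ᶠ[𝓝 z₀] F := by
    have h := eventually_nhdsWithin_iff.1 hev
    filter_upwards [h, Metric.closedBall_mem_nhds z₀ hε] with z hz hzb
    by_cases h0 : z = z₀
    · rw [h0]; simp [g]
    · have hne := hp0 z hzb h0
      simp only [g, Function.update_of_ne h0]
      rw [div_eq_iff hne, ← sub_eq_zero.1 (hz h0), mul_comm]
  have hgd : ∀ z ∈ Metric.closedBall z₀ ε, z ≠ z₀ → DifferentiableAt ℂ g z := by
    intro z hz h0
    have h1 : DifferentiableAt ℂ (fun z => f z / p z) z :=
      ((hf z (hball hz)).differentiableAt (hU.mem_nhds (hball hz))).div (hp z) (hp0 z hz h0)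
    refine h1.congr_of_eventuallyEq ?_
    filter_upwards [isOpen_ne.mem_nhds h0] with w hw
    simp only [g, Function.update_of_ne hw]
  have hgc : ContinuousOn g (Metric.closedBall z₀ ε) := by
    intro z hz
    by_cases h0 : z = z₀
    · rw [h0]
      exact (hF0.continuousAt.congr hgF.symm).continuousWithinAt
    · exact (hgd z hz h0).continuousAt.continuousWithinAt
  have hC := Complex.circleIntegral_sub_center_inv_smul_of_differentiable_on_off_countable hε
    (Set.countable_singleton z₀) hgc fun z hz =>
      hgd z (Metric.ball_subset_closedBall hz.1) hz.2
  have hg0 : g z₀ = F z₀ := by simp [g]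
  rw [hg0, smul_eq_mul] at hC
  rw [eq_inv_mul_iff_mul_eq₀ two_pi_I_ne_zero, ← hC]
  refine circleIntegral.integral_congr hε.le fun z hz => ?_
  have h0 : z ≠ z₀ := fun h => by simp [h, hε.ne] at hz
  simp only [g, Function.update_of_ne h0, smul_eq_mul]

namespace ConeZeta
variable {κ : Type*}

theorem add_pos_of_mem_Icc {x t : κ → ℝ} (hx : ∀ i, 0 < x i) (ht : t ∈ Set.Icc (0 : κ → ℝ) 1)
    (i : κ) : 0 < (x + t) i :=
  add_pos_of_pos_of_nonneg (hx i) (ht.1 i)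

theorem IsHolomorphicFamily.continuousOn_add {M : ℝ} {f : ℂ → (κ → ℝ) → ℂ}
    (hf : IsHolomorphicFamily M f) {x : κ → ℝ} (hx : ∀ i, 0 < x i) :
    ContinuousOn (fun q : ℂ × (κ → ℝ) => f q.1 (x + q.2))
      ({s | -M < s.re} ×ˢ Set.Icc (0 : κ → ℝ) 1) :=
  hf.continuousOn.comp (f := fun q : ℂ × (κ → ℝ) => (q.1, x + q.2)) (by fun_prop)
    fun _ hq => ⟨hq.1, add_pos_of_mem_Icc hx hq.2⟩

variable [Fintype κ]

theorem IsHolomorphicFamily.differentiableOn_integral {M : ℝ} {f : ℂ → (κ → ℝ) → ℂ}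
    (hf : IsHolomorphicFamily M f) {x : κ → ℝ} (hx : ∀ i, 0 < x i) :
    DifferentiableOn ℂ (fun s => ∫ t in Set.Icc (0 : κ → ℝ) 1, f s (x + t)) {s | -M < s.re} := by
  have hU : IsOpen {s : ℂ | -M < s.re} := isOpen_lt continuous_const Complex.continuous_re
  refine differentiableOn_integral_of_locally_dominated hU (fun s hs => ?_) ?_ fun s₀ hs₀ => ?_
  · refine ContinuousOn.aestronglyMeasurable ?_ measurableSet_Icc
    exact (hf.continuousOn_add hx).comp (f := fun t : κ → ℝ => (s, t)) (by fun_prop)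
      fun t ht => ⟨hs, ht⟩
  · filter_upwards [ae_restrict_mem measurableSet_Icc] with t ht
    exact hf.differentiableOn _ (add_pos_of_mem_Icc hx ht)
  · obtain ⟨δ, hδ, hsub⟩ := Metric.nhds_basis_closedBall.mem_iff.1 (hU.mem_nhds hs₀)
    obtain ⟨C, hC⟩ := ((isCompact_closedBall s₀ δ).prod
      (isCompact_Icc (a := (0 : κ → ℝ)) (b := 1))).exists_bound_of_continuousOn
      ((hf.continuousOn_add hx).mono (Set.prod_mono hsub subset_rfl))
    refine ⟨_, Metric.closedBall_mem_nhds s₀ hδ, fun _ => C, ?_, ?_⟩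
    · exact integrableOn_const isCompact_Icc.measure_lt_top.ne
    · filter_upwards [ae_restrict_mem measurableSet_Icc] with t ht s hs
      exact hC (s, t) ⟨hs, ht⟩

/-- If a function and its mean over a unit cube are, up to a common polynomial factor, given by a
holomorphic family and its mean, then the values of their continuations are related in the same
way. -/
theorem eval_eq_integral_eval {M R : ℝ} {z₀ : ℂ} (hz₀ : -M < z₀.re) {p : Polynomial ℂ}
    (hp : p ≠ 0) {f : ℂ → (κ → ℝ) → ℂ} (hf : IsHolomorphicFamily M f) {x : κ → ℝ}
    (hx : ∀ i, 0 < x i) {F : (κ → ℝ) → ℂ → ℂ} {H : ℂ → ℂ}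
    (hF : ∀ y : κ → ℝ, (∀ i, 0 < y i) → MeromorphicOn (F y) Set.univ ∧ AnalyticAt ℂ (F y) z₀ ∧
      ∀ s : ℂ, R < s.re → p.eval s * F y s = f s y)
    (hH : MeromorphicOn H Set.univ) (hH0 : AnalyticAt ℂ H z₀)
    (hpH : ∀ s : ℂ, R < s.re →
      p.eval s * H s = ∫ t in Set.Icc (0 : κ → ℝ) 1, f s (x + t)) :
    H z₀ = ∫ t in Set.Icc (0 : κ → ℝ) 1, F (x + t) z₀ := by
  have hU : IsOpen {s : ℂ | -M < s.re} := isOpen_lt continuous_const Complex.continuous_re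
  obtain ⟨ε, hε, hsub⟩ : ∃ ε > 0, Metric.closedBall z₀ ε ⊆
      {s | -M < s.re} ∩ ({s | p.IsRoot s} \ {z₀})ᶜ :=
    Metric.nhds_basis_closedBall.mem_iff.1 (Filter.inter_mem (hU.mem_nhds hz₀)
      (((Polynomial.finite_setOfPred_isRoot hp).sdiff).isClosed.isOpen_compl.mem_nhds (by simp)))
  have hball : Metric.closedBall z₀ ε ⊆ {s | -M < s.re} := fun z hz => (hsub hz).1
  have hp0 : ∀ z ∈ Metric.closedBall z₀ ε, z ≠ z₀ → p.eval z ≠ 0 := fun z hz hne h =>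
    (hsub hz).2 ⟨h, hne⟩
  have hval : ∀ t ∈ Set.Icc (0 : κ → ℝ) 1, F (x + t) z₀ =
      (2 * Real.pi * I)⁻¹ * ∮ z in C(z₀, ε), (z - z₀)⁻¹ * (f z (x + t) / p.eval z) := by
    intro t ht
    have hy := add_pos_of_mem_Icc hx ht
    obtain ⟨h1, h2, h3⟩ := hF _ hy
    exact eval_eq_circleIntegral_of_mul_eq hε hball p.differentiable hp0
      (hf.differentiableOn _ hy) h1 h2 h3
  rw [setIntegral_congr_fun measurableSet_Icc hval, integral_const_mul,
    eval_eq_circleIntegral_of_mul_eq hε hball p.differentiable hp0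
      (hf.differentiableOn_integral hx) hH hH0 hpH]
  congr 1
  have hcircle : ∀ θ, circleMap z₀ ε θ ∈ Metric.closedBall z₀ ε := fun θ =>
    circleMap_mem_closedBall z₀ hε.le θ
  have hne : ∀ θ, circleMap z₀ ε θ ≠ z₀ := fun θ => circleMap_ne_center hε.ne'
  simp only [circleIntegral]
  rw [← intervalIntegral_integral_swap]
  · refine intervalIntegral.integral_congr fun θ _ => ?_
    simp only [smul_eq_mul]
    rw [integral_const_mul, integral_const_mul, integral_div]
  · rw [Measure.prod_restrict]
    refine IntegrableOn.mono_set (t := Set.uIcc 0 (2 * Real.pi) ×ˢ Set.Icc (0 : κ → ℝ) 1) ?_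
      (Set.prod_mono Set.uIoc_subset_uIcc subset_rfl)
    refine ContinuousOn.integrableOn_compact (isCompact_uIcc.prod isCompact_Icc) ?_
    have hcont := (continuous_circleMap z₀ ε).comp (continuous_fst (X := ℝ) (Y := κ → ℝ))
    have h1 : ContinuousOn (fun q : ℝ × (κ → ℝ) => f (circleMap z₀ ε q.1) (x + q.2))
        (Set.uIcc 0 (2 * Real.pi) ×ˢ Set.Icc (0 : κ → ℝ) 1) :=
      (hf.continuousOn_add hx).comp (f := fun q : ℝ × (κ → ℝ) => (circleMap z₀ ε q.1, q.2))
        (hcont.prodMk continuous_snd).continuousOn fun q hq => ⟨hball (hcircle _), hq.2⟩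
    have h2 : Continuous fun q : ℝ × (κ → ℝ) => deriv (circleMap z₀ ε) q.1 := by
      simp only [deriv_circleMap]
      exact ((continuous_circleMap 0 ε).comp continuous_fst).mul continuous_const
    have h3 : Continuous fun q : ℝ × (κ → ℝ) => (circleMap z₀ ε q.1 - z₀)⁻¹ :=
      (hcont.sub continuous_const).inv₀ fun q => sub_ne_zero.2 (hne _)
    exact h2.continuousOn.smul (h3.continuousOn.mul (h1.div
      (p.continuous.comp hcont).continuousOn fun q _ => hp0 _ (hcircle _) (hne _)))

variable {ι : Type*} [Fintype ι] {c : κ → ι → ℝ}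

/-- The mean value formula for the values of the continuations of the zeta series and the zeta
integral attached to a family of linear forms. -/
theorem eval_zetaInt_eq_integral_eval_zeta (hc : IsPairing c) (hd : DegreeGE c (-1) 0 1) (l : ℕ)
    {R : ℝ} (hR : 1 ≤ R) {x : κ → ℝ} (hx : ∀ i, 0 < x i) {F : (κ → ℝ) → ℂ → ℂ} {H : ℂ → ℂ}
    (hF : ∀ y : κ → ℝ, (∀ i, 0 < y i) →
      (∀ s : ℂ, R < s.re → F y s =
        ∑' m : κ → ℕ, ∏ α, (colForm c (y + fun i => (m i : ℝ)) α : ℂ) ^ (-s)) ∧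
      MeromorphicOn (F y) Set.univ ∧ AnalyticAt ℂ (F y) (-(l : ℂ)))
    (hHs : ∀ s : ℂ, R < s.re → H s =
      ∫ t in {t : κ → ℝ | ∀ i, 0 < t i}, ∏ α, (colForm c (x + t) α : ℂ) ^ (-s))
    (hH : MeromorphicOn H Set.univ) (hH0 : AnalyticAt ℂ H (-(l : ℂ))) :
    H (-(l : ℂ)) = ∫ t in Set.Icc (0 : κ → ℝ) 1, F (x + t) (-(l : ℂ)) := by
  obtain ⟨p, hp, g, hg, hpg⟩ := hasContinuation_mellinInt hc isDerivTower_toddDeriv (l + 1) hd 0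
  have hΓ : ∀ s : ℂ, R < s.re → (Gamma s)⁻¹ ^ Fintype.card ι * Gamma s ^ Fintype.card ι = 1 := by
    intro s hs
    rw [← mul_pow, inv_mul_cancel₀ (Gamma_ne_zero_of_re_pos (by linarith)), one_pow]
  have hfam := (isHolomorphicFamily_of_differentiable (κ := κ) (M := ((l + 1 : ℤ) : ℝ))
    (differentiable_one_div_Gamma.pow (Fintype.card ι))).mul hg
  refine eval_eq_integral_eval (R := R) (by simp) hp hfam hx (fun y hy => ?_) hH hH0 ?_
  · obtain ⟨h1, h2, h3⟩ := hF y hy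
    refine ⟨h2, h3, fun s hs => ?_⟩
    simp only [Pi.pow_apply]
    rw [← hpg s y (hR.trans_lt hs) hy, ← tsum_prod_colForm hc hd (hR.trans_lt hs) hy, h1 s hs]
    rw [mul_left_comm (_ ^ _), ← mul_assoc ((Gamma s)⁻¹ ^ _), hΓ s hs, one_mul]
  · intro s hs
    simp only [Pi.pow_apply]
    have h : ∀ t ∈ Set.Icc (0 : κ → ℝ) 1, (Gamma s)⁻¹ ^ Fintype.card ι * g s (x + t) =
        (Gamma s)⁻¹ ^ Fintype.card ι * (p.eval s * mellinInt c toddDeriv 0 1 0 s (x + t)) :=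
      fun t ht => by rw [hpg s _ (hR.trans_lt hs) (add_pos_of_mem_Icc hx ht)]
    rw [setIntegral_congr_fun measurableSet_Icc h, integral_const_mul, integral_const_mul,
      ← integral_prod_colForm hc hd (hR.trans_lt hs) hx, hHs s hs]
    rw [mul_left_comm (_ ^ _), ← mul_assoc ((Gamma s)⁻¹ ^ _), hΓ s hs, one_mul]

end ConeZeta

namespace RootSystemData

/-- The pairings of the fundamental weights with the positive coroots. -/
def posPairing (S : RootSystemData r E) (i : Fin r) (α : {α // α ∈ S.pos}) : ℝ := S.pairing i α

theorem pairing_simple (S : RootSystemData r E) (i j : Fin r) :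
    S.pairing i (S.simple j) = if i = j then 1 else 0 := S.weight_dual i j

theorem inner_self_pos (S : RootSystemData r E) {α : E} (hα : α ∈ S.pos) : 0 < ⟪α, α⟫ :=
  real_inner_self_pos.2 (S.ne_zero α (S.pos_subset hα))

theorem inner_weight_simple (S : RootSystemData r E) (i j : Fin r) :
    ⟪S.weight i, S.simple j⟫ = if i = j then ⟪S.simple j, S.simple j⟫ / 2 else 0 := by
  have h := S.weight_dual i j
  have hpos := S.inner_self_pos (S.simple_mem_pos j)
  rw [inner_smul_right] at h
  have h2 : ⟪S.weight i, S.simple j⟫ =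
      ⟪S.simple j, S.simple j⟫ / 2 * (2 / ⟪S.simple j, S.simple j⟫ * ⟪S.weight i, S.simple j⟫) := by
    field_simp
  rw [h2, h]
  split_ifs <;> simp

theorem pairing_eq (S : RootSystemData r E) (i : Fin r) {α : E} {m : Fin r → ℕ}
    (hm : α = ∑ i, (m i : ℝ) • S.simple i) :
    S.pairing i α = 2 / ⟪α, α⟫ * (m i * (⟪S.simple i, S.simple i⟫ / 2)) := by
  have h : ⟪S.weight i, α⟫ = m i * (⟪S.simple i, S.simple i⟫ / 2) := by
    rw [hm, inner_sum]
    simp [inner_smul_right, inner_weight_simple]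
  rw [pairing, inner_smul_right, h]

theorem isPairing_posPairing (S : RootSystemData r E) : IsPairing S.posPairing where
  nonneg i α := by
    obtain ⟨m, hm⟩ := S.simple_base α α.2
    rw [posPairing, S.pairing_eq i hm]
    have := S.inner_self_pos α.2
    have := S.inner_self_pos (S.simple_mem_pos i)
    positivity
  row i := ⟨⟨S.simple i, S.simple_mem_pos i⟩, by simp [posPairing, pairing_simple]⟩
  col α := by
    obtain ⟨m, hm⟩ := S.simple_base α α.2
    obtain ⟨i, hi⟩ : ∃ i, m i ≠ 0 := by
      by_contra! h
      exact S.ne_zero α (S.pos_subset α.2) (by rw [hm]; simp [h])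
    refine ⟨i, ?_⟩
    rw [posPairing, S.pairing_eq i hm]
    have := S.inner_self_pos α.2
    have := S.inner_self_pos (S.simple_mem_pos i)
    have : 0 < m i := Nat.pos_of_ne_zero hi
    positivity

theorem degreeGE_posPairing (S : RootSystemData r E) :
    ConeZeta.DegreeGE S.posPairing (-1) 0 1 := by
  intro A
  simp only [ConeZeta.degree, Pi.zero_apply, Pi.one_apply, Nat.cast_zero, Nat.cast_one,
    Finset.sum_const_zero, Finset.sum_const, nsmul_eq_mul, mul_one]
  rw [zero_sub, neg_mul, one_mul, neg_le_neg_iff, Nat.cast_le]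
  refine Finset.card_le_card_of_injOn (fun i => ⟨S.simple i, S.simple_mem_pos i⟩)
    (fun i hi => ?_) fun i _ j _ hij => S.simple_inj (congrArg Subtype.val hij)
  have hi' : ConeZeta.rowSupp S.posPairing i ⊆ A := by simpa using hi
  exact hi' (Finset.mem_filter.2 ⟨Finset.mem_univ _, by simp [posPairing, pairing_simple]⟩)

theorem prod_pos_eq (S : RootSystemData r E) (s : ℂ) (z : Fin r → ℝ) :
    ∏ α ∈ S.pos, ((∑ i, z i * S.pairing i α : ℝ) : ℂ) ^ (-s) =
      ∏ α, (ConeZeta.colForm S.posPairing z α : ℂ) ^ (-s) :=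
  (Finset.prod_coe_sort S.pos fun α => ((∑ i, z i * S.pairing i α : ℝ) : ℂ) ^ (-s)).symm

end RootSystemData

theorem zetaRS_eq (S : RootSystemData r E) (s : ℂ) (x : Fin r → ℝ) :
    zetaRS S s x = ∑' m : Fin r → ℕ,
      ∏ α, (ConeZeta.colForm S.posPairing (x + fun i => (m i : ℝ)) α : ℂ) ^ (-s) := by
  simp only [← S.prod_pos_eq, zetaRS, Pi.add_apply, add_comm]

theorem zetaIntRS_eq (S : RootSystemData r E) (s : ℂ) (x : Fin r → ℝ) :
    zetaIntRS S s x = ∫ t in {t : Fin r → ℝ | ∀ i, 0 < t i},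
      ∏ α, (ConeZeta.colForm S.posPairing (x + t) α : ℂ) ^ (-s) := by
  simp only [← S.prod_pos_eq, zetaIntRS, Pi.add_apply, add_comm]

/-- Raabe formula for the root-system polynomials:
`Q_ℓ(x) = ∫_{[0,1]^r} P_ℓ(x+t) dt`. -/
theorem Ql_eq_integral_Pl {r : ℕ} (hr : 0 < r) {E : Type*} [NormedAddCommGroup E]
    [InnerProductSpace ℝ E] (hdim : Module.finrank ℝ E = r)
    (S : RootSystemData r E) (l : ℕ)
    (P Q : (Fin r → ℝ) → ℂ)
    (hPval : ∀ x : Fin r → ℝ, (∀ i, 0 < x i) → IsPValue S l x (P x))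
    (hQval : ∀ x : Fin r → ℝ, (∀ i, 0 < x i) → IsQValue S l x (Q x)) :
    ∀ x : Fin r → ℝ, (∀ i, 0 < x i) →
      Q x = ∫ t in Set.Icc (0 : Fin r → ℝ) 1, P (x + t) := by
  intro x hx
  choose! F hFs hFm hFa hFv using hPval
  obtain ⟨H, hHs, hHm, hHa, hHv⟩ := hQval x hx
  have hmain := ConeZeta.eval_zetaInt_eq_integral_eval_zeta S.isPairing_posPairing
    S.degreeGE_posPairing l (R := r) (by exact_mod_cast hr) hx (F := F) (H := H)
    (fun y hy => ⟨fun s hs => by rw [hFs y hy s hs, zetaRS_eq], hFm y hy, hFa y hy⟩)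
    (fun s hs => by rw [hHs s hs, zetaIntRS_eq]) hHm hHa
  rw [← hHv, hmain]
  exact setIntegral_congr_fun measurableSet_Icc fun t ht =>
    hFv _ (ConeZeta.add_pos_of_mem_Icc hx ht)
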